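/- arXiv:math/9910108 — 2 statements merged into one kernel-verified Lean document; each statement's English description precedes it below -/
import Mathlib

section
/- Let W be an open connected subset of ℝ² whose complement is compact with nonempty interior, and let γ : [0,∞) → ℝ² be a continuous injective map (a proper ray) with γ(0) ∈ ∂W, γ((0,∞)) ⊆ W, and |γ(t)| → ∞ as t → ∞. Then W \ γ([0,∞)) is connected. -/
open Metric Set Filter

/-- The plane `ℝ²`. -/
abbrev Plane := EuclideanSpace ℝ (Fin 2)

/-- A continuous nonvanishing complex function on a simply connected space has a logarithm. -/
theorem exists_continuous_exp_eq {E : Type*} [TopologicalSpace E] [SimplyConnectedSpace E]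
    [LocallyPathConnectedSpace E] {f : E → ℂ} (hf : Continuous f) (h0 : ∀ x, f x ≠ 0) :
    ∃ L : E → ℂ, Continuous L ∧ ∀ x, Complex.exp (L x) = f x := by
  obtain ⟨x₀⟩ : Nonempty E := inferInstance
  obtain ⟨F, ⟨-, hF⟩, -⟩ := Complex.isCoveringMapOn_exp.existsUnique_continuousMap_lifts
    ⟨f, hf⟩ (a₀ := x₀) (Complex.exp_log (h0 x₀)) h0
  exact ⟨F, F.continuous, fun x => congrFun hF x⟩

/-- Two logarithms of the same function on a preconnected set differ by a constant. -/
theorem IsPreconnected.log_sub_log_eq {E : Type*} [TopologicalSpace E] {S : Set E}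
    (hS : IsPreconnected S) {L₁ L₂ : E → ℂ} (h₁ : ContinuousOn L₁ S) (h₂ : ContinuousOn L₂ S)
    (h : ∀ x ∈ S, Complex.exp (L₁ x) = Complex.exp (L₂ x)) {x y : E} (hx : x ∈ S) (hy : y ∈ S) :
    L₁ x - L₂ x = L₁ y - L₂ y := by
  have hd : IsDiscrete
      ((AddSubgroup.zmultiples (2 * Real.pi * Complex.I) : AddSubgroup ℂ) : Set ℂ) :=
    ⟨NormedSpace.discreteTopology_zmultiples _⟩
  refine hS.constant_of_mapsTo hd (f := fun z => L₁ z - L₂ z) (h₁.sub h₂) (fun z hz => ?_) hx hy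
  obtain ⟨n, hn⟩ := Complex.exp_eq_exp_iff_exists_int.1 (h z hz)
  exact ⟨n, by simp [hn]⟩

/-- The function `z - p` has no continuous logarithm near infinity. -/
theorem not_exp_eq_sub_near_infinity {L : ℂ → ℂ} (hL : Continuous L) (p : ℂ) (R : ℝ)
    (h : ∀ z, R ≤ ‖z‖ → Complex.exp (L z) = z - p) : False := by
  set r : ℝ := |R| + ‖p‖ + 1 with hr
  have hr0 : 0 < r := by positivity
  let c : ℝ → ℂ := fun θ => p + r * Complex.exp (θ * Complex.I)
  have hc : ∀ θ, R ≤ ‖c θ‖ := fun θ => by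
    have h1 := norm_sub_le (c θ) p
    have h2 : ‖c θ - p‖ = r := by
      simp [c, Complex.norm_exp_ofReal_mul_I, abs_of_pos hr0]
    have := le_abs_self R
    linarith
  have key := isPreconnected_univ.log_sub_log_eq (L₁ := fun θ : ℝ => L (c θ))
    (L₂ := fun θ : ℝ => Real.log r + θ * Complex.I) (by fun_prop) (by fun_prop)
    (fun θ _ => by
      rw [h _ (hc θ), Complex.exp_add, ← Complex.ofReal_exp, Real.exp_log hr0]
      simp [c]) (mem_univ 0) (mem_univ (2 * Real.pi))
  simp [c, Complex.exp_two_pi_mul_I] at key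

/-- If `p` and `q` lie in a common connected subset of the complement of a closed set, then
`(z - p) / (z - q)` has a continuous logarithm on that closed set. -/
theorem IsPreconnected.exists_log_on_compl {W : Set ℂ} (hW : IsPreconnected W) (hWo : IsOpen W)
    {p q : ℂ} (hp : p ∈ W) (hq : q ∈ W) :
    ∃ g : ℂ → ℂ, ContinuousOn g Wᶜ ∧ ∀ z ∈ Wᶜ, Complex.exp (g z) * (z - q) = z - p := by
  refine hW.induction₂ (fun p q => ∃ g : ℂ → ℂ, ContinuousOn g Wᶜ ∧
    ∀ z ∈ Wᶜ, Complex.exp (g z) * (z - q) = z - p) (fun x hx => ?_) ?_ ?_ hp hq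
  · obtain ⟨δ, hδ, hball⟩ := Metric.isOpen_iff.1 hWo x hx
    filter_upwards [mem_nhdsWithin_of_mem_nhds (Metric.ball_mem_nhds x hδ)] with y hy
    have hne : ∀ z ∈ Wᶜ, z - x ≠ 0 := fun z hz h => hz (by rwa [sub_eq_zero.1 h])
    have hslit : ∀ z ∈ Wᶜ, (z - y) / (z - x) ∈ Complex.slitPlane := fun z hz => by
      apply Complex.ball_one_subset_slitPlane
      have h1 : (z - y) / (z - x) - 1 = (x - y) / (z - x) := by
        have := hne z hz
        field_simp
        ring
      have h2 : δ ≤ ‖z - x‖ := by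
        by_contra! h
        exact hz (hball (by simpa [dist_eq_norm] using h))
      rw [Metric.mem_ball, dist_eq_norm, h1, norm_div, div_lt_one (by linarith)]
      rw [Metric.mem_ball', dist_eq_norm] at hy
      linarith
    refine ⟨fun z => -Complex.log ((z - y) / (z - x)), ?_, fun z hz => ?_⟩
    · refine (ContinuousOn.clog (ContinuousOn.div (by fun_prop) (by fun_prop) hne) hslit).neg
    · have h1 := Complex.slitPlane_ne_zero (hslit z hz)
      have h2 := hne z hz
      rw [Complex.exp_neg, Complex.exp_log h1]
      have h3 : z - y ≠ 0 := fun h => h1 (by simp [h])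
      field_simp
  · rintro x y z - - - ⟨g, hg, hg'⟩ ⟨k, hk, hk'⟩
    refine ⟨fun z => g z + k z, hg.add hk, fun w hw => ?_⟩
    rw [Complex.exp_add, mul_assoc, hk' w hw, hg' w hw]
  · rintro x y - - ⟨g, hg, hg'⟩
    refine ⟨fun z => -g z, hg.neg, fun w hw => ?_⟩
    rw [← hg' w hw, ← mul_assoc, ← Complex.exp_add]
    simp

/-- Continuous functions on two closed sets that agree on the intersection can be glued. -/
theorem exists_continuousOn_union {α β : Type*} [TopologicalSpace α] [TopologicalSpace β]
    {A B : Set α} (hA : IsClosed A) (hB : IsClosed B) {a b : α → β} (ha : ContinuousOn a A)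
    (hb : ContinuousOn b B) (hab : EqOn a b (A ∩ B)) :
    ∃ g : α → β, ContinuousOn g (A ∪ B) ∧ EqOn g a A ∧ EqOn g b B := by
  classical
  have h1 : EqOn (A.piecewise a b) a A := piecewise_eqOn A a b
  have h2 : EqOn (A.piecewise a b) b B := fun x hx => by
    by_cases hxA : x ∈ A
    · rw [h1 hxA, hab ⟨hxA, hx⟩]
    · exact piecewise_eq_of_notMem A a b hxA
  exact ⟨_, (ha.congr h1).union_of_isClosed (hb.congr h2) hA hB, h1, h2⟩

/-- If `(z - p) / (z - q)` has a continuous logarithm on a closed set `Y` containing a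
neighbourhood of infinity, then no subset of `Y` separates `p` from `q`. -/
theorem not_separated_of_log {Y U V : Set ℂ} (hY : IsClosed Y) (hU : IsOpen U) (hV : IsOpen V)
    (hdisj : Disjoint U V) (hUV : (U ∪ V)ᶜ ⊆ Y) {R : ℝ} (hR : ∀ z, R ≤ ‖z‖ → z ∈ Y)
    {p q : ℂ} (hp : p ∈ U) (hq : q ∈ V) {g : ℂ → ℂ} (hg : ContinuousOn g Y)
    (hgY : ∀ z ∈ Y, Complex.exp (g z) * (z - q) = z - p) : False := by
  classical
  obtain ⟨G, hG⟩ := ContinuousMap.exists_restrict_eq hY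
    ⟨Y.domRestrict g, continuousOn_iff_continuous_domRestrict.1 hg⟩
  have hGY : ∀ z ∈ Y, Complex.exp (G z) * (z - q) = z - p := fun z hz => by
    rw [← hgY z hz, show G z = g z from congrArg (fun k => k ⟨z, hz⟩) hG]
  obtain ⟨F, hF, hFV, hFU⟩ := exists_continuousOn_union (A := Vᶜ) (B := Uᶜ)
    (a := fun z => Complex.exp (G z) * (z - q)) (b := fun z => z - p)
    hV.isClosed_compl hU.isClosed_compl (by fun_prop) (by fun_prop)
    (fun z hz => hGY z (hUV fun h => h.elim hz.2 hz.1))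
  have hcover : ∀ z, z ∈ Vᶜ ∨ z ∈ Uᶜ := fun z => by
    by_contra! h
    exact disjoint_left.1 hdisj (not_not.1 h.2) (not_not.1 h.1)
  rw [eq_univ_of_forall (s := Vᶜ ∪ Uᶜ) hcover, continuousOn_univ] at hF
  obtain ⟨L, hL, hLF⟩ := exists_continuous_exp_eq hF fun z => by
    rcases hcover z with h | h
    · rw [hFV h]
      exact mul_ne_zero (Complex.exp_ne_zero _) (sub_ne_zero.2 fun e => h (e ▸ hq))
    · rw [hFU h]
      exact sub_ne_zero.2 fun e => h (e ▸ hp)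
  refine not_exp_eq_sub_near_infinity hL p R fun z hz => ?_
  rw [hLF]
  rcases hcover z with h | h
  · rw [hFV h]
    exact hGY z (hR z hz)
  · rw [hFU h]

open NNReal in
/-- On the union of a proper ray and a neighbourhood of infinity, the function
`(z - p) / (z - q)` has a continuous logarithm if the ray avoids `p` and `q`. -/
theorem exists_log_on_ray {γ : ℝ≥0 → ℂ} (hγ : Topology.IsClosedEmbedding γ)
    (hlim : Tendsto (fun t => ‖γ t‖) atTop atTop) {p q : ℂ} (hp : p ∉ range γ) (hq : q ∉ range γ)
    (R₀ : ℝ) :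
    ∃ R, R₀ < R ∧ ∃ g : ℂ → ℂ, ContinuousOn g (range γ ∪ {z | R ≤ ‖z‖}) ∧
      ∀ z ∈ range γ ∪ {z | R ≤ ‖z‖}, Complex.exp (g z) * (z - q) = z - p := by
  have hp' : ∀ t, γ t - p ≠ 0 := fun t h => hp ⟨t, sub_eq_zero.1 h⟩
  have hq' : ∀ t, γ t - q ≠ 0 := fun t h => hq ⟨t, sub_eq_zero.1 h⟩
  have hγc := hγ.continuous
  obtain ⟨L, hL, hLe⟩ := exists_continuous_exp_eq (E := ℝ)
    (f := fun t => (γ t.toNNReal - p) / (γ t.toNNReal - q))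
    (Continuous.div (by fun_prop) (by fun_prop) fun t => hq' _)
    (fun t => div_ne_zero (hp' _) (hq' _))
  let R₁ : ℝ := ‖q‖ + ‖p - q‖ + 1
  have hbig : ∀ z, R₁ ≤ ‖z‖ → z - q ≠ 0 ∧ (z - p) / (z - q) ∈ Complex.slitPlane := fun z hz => by
    have h1 := norm_sub_norm_le z q
    have h2 : ‖p - q‖ < ‖z - q‖ := by simp only [R₁] at hz; linarith
    have h3 : z - q ≠ 0 := norm_pos_iff.1 ((norm_nonneg _).trans_lt h2)
    refine ⟨h3, Complex.ball_one_subset_slitPlane ?_⟩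
    have h4 : (z - p) / (z - q) - 1 = -((p - q) / (z - q)) := by
      field_simp
      ring
    rwa [Metric.mem_ball, dist_eq_norm, h4, norm_neg, norm_div, div_lt_one (by positivity)]
  obtain ⟨T, hT⟩ := eventually_atTop.1 (hlim.eventually_ge_atTop R₁)
  obtain ⟨B, hB⟩ := (isCompact_Icc (a := (0 : ℝ≥0)) (b := T)).exists_bound_of_continuousOn
    hγc.continuousOn
  let l : ℂ → ℂ := fun z => Complex.log ((z - p) / (z - q))
  have hl : ContinuousOn l {z | R₁ ≤ ‖z‖} :=
    (ContinuousOn.div (by fun_prop) (by fun_prop) fun z hz => (hbig z hz).1).clog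
      fun z hz => (hbig z hz).2
  have hle : ∀ z, R₁ ≤ ‖z‖ → Complex.exp (l z) = (z - p) / (z - q) := fun z hz =>
    Complex.exp_log (Complex.slitPlane_ne_zero (hbig z hz).2)
  let k : ℂ := L T - l (γ T)
  have hk : ∀ t, T ≤ t → L t - l (γ t) = k := fun t ht =>
    isPreconnected_Ici.log_sub_log_eq (S := Ici T) (L₁ := fun t : ℝ≥0 => L t)
      (L₂ := fun t : ℝ≥0 => l (γ t)) (by fun_prop)
      (hl.comp hγc.continuousOn fun t ht => hT t ht)
      (fun t ht => by rw [hLe, hle _ (hT t ht), Real.toNNReal_coe]) ht self_mem_Ici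
  have hke : Complex.exp k = 1 := by
    rw [Complex.exp_sub, hLe, hle _ (hT T le_rfl), Real.toNNReal_coe]
    exact div_self (div_ne_zero (hp' _) (hq' _))
  obtain ⟨a, ha⟩ := ContinuousMap.exists_extension hγ ⟨fun t : ℝ≥0 => L t, by fun_prop⟩
  have ha' : ∀ t, a (γ t) = L t := fun t => congrArg (fun f => f t) ha
  let R : ℝ := max (R₀ + 1) (max R₁ (B + 1))
  have hR₁ : R₁ ≤ R := (le_max_left _ _).trans (le_max_right _ _)
  have hRB : B + 1 ≤ R := (le_max_right _ _).trans (le_max_right _ _)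
  obtain ⟨g, hg, hga, hgl⟩ := exists_continuousOn_union (A := range γ) (B := {z | R ≤ ‖z‖})
    (a := a) (b := fun z => l z + k) hγ.isClosed_range (isClosed_le continuous_const continuous_norm)
    a.continuous.continuousOn ((hl.mono fun z hz => hR₁.trans hz).add continuousOn_const) (by
      rintro _ ⟨⟨t, rfl⟩, ht : R ≤ ‖γ t‖⟩
      have hTt : T ≤ t := by
        by_contra! h
        linarith [hB t ⟨zero_le, h.le⟩]
      simp only [ha', ← hk t hTt, add_sub_cancel])
  refine ⟨R, (lt_add_one _).trans_le (le_max_left _ _), g, hg, ?_⟩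
  rintro z (⟨t, rfl⟩ | hz)
  · rw [hga ⟨t, rfl⟩, ha', hLe, Real.toNNReal_coe, div_mul_cancel₀ _ (hq' _)]
  · have hz' : R₁ ≤ ‖z‖ := hR₁.trans hz
    rw [hgl hz, Complex.exp_add, hke, mul_one, hle _ hz', div_mul_cancel₀ _ (hbig z hz').1]

open NNReal in
/-- Removing a proper ray starting on the boundary from a connected open neighbourhood of infinity
in the complex plane leaves a preconnected set. -/
theorem isPreconnected_diff_ray {W : Set ℂ} (hWo : IsOpen W) (hW : IsPreconnected W)
    (hK : IsCompact Wᶜ) {γ : ℝ≥0 → ℂ} (hγ : Topology.IsClosedEmbedding γ)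
    (hlim : Tendsto (fun t => ‖γ t‖) atTop atTop) (h0 : γ 0 ∉ W) (hpos : ∀ t, 0 < t → γ t ∈ W) :
    IsPreconnected (W \ range γ) := by
  rw [isPreconnected_iff_subset_of_disjoint]
  by_contra! hcon
  obtain ⟨U, V, hU, hV, hcover, hdisj, hnU, hnV⟩ := hcon
  obtain ⟨q, hq, hqU⟩ := not_subset.1 hnU
  obtain ⟨p, hp, hpV⟩ := not_subset.1 hnV
  have hΩ : IsOpen (W \ range γ) := hWo.sdiff hγ.isClosed_range
  have hpU : p ∈ U := (hcover hp).resolve_right hpV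
  have hqV : q ∈ V := (hcover hq).resolve_left hqU
  obtain ⟨R₀, hR₀⟩ := hK.isBounded.exists_norm_le
  obtain ⟨R, hR, g, hg, hge⟩ := exists_log_on_ray hγ hlim hp.2 hq.2 R₀
  obtain ⟨k, hk, hke⟩ := hW.exists_log_on_compl hWo hp.1 hq.1
  have hγq : γ 0 - q ≠ 0 := fun h => hq.2 ⟨0, sub_eq_zero.1 h⟩
  let c : ℂ := g (γ 0) - k (γ 0)
  have hc : Complex.exp c = 1 := by
    rw [Complex.exp_sub, div_eq_one_iff_eq (Complex.exp_ne_zero _)]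
    exact mul_right_cancel₀ hγq ((hge _ (Or.inl ⟨0, rfl⟩)).trans (hke _ h0).symm)
  have hclosed : IsClosed (range γ ∪ {z | R ≤ ‖z‖}) :=
    hγ.isClosed_range.union (isClosed_le continuous_const continuous_norm)
  obtain ⟨f, hf, hfk, hfg⟩ := exists_continuousOn_union (A := Wᶜ)
    (a := fun z => k z + c) (b := g) hWo.isClosed_compl hclosed (hk.add continuousOn_const) hg (by
      rintro z ⟨hzW, ⟨t, rfl⟩ | hz⟩
      · obtain rfl : t = 0 := by
          by_contra ht
          exact hzW (hpos t (pos_iff_ne_zero.2 ht))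
        simp [c]
      · exact absurd (hR₀ z hzW) (not_le.2 (hR.trans_le hz)))
  refine not_separated_of_log (hWo.isClosed_compl.union hclosed) (hΩ.inter hU) (hΩ.inter hV) ?_ ?_
    (fun z hz => Or.inr (Or.inr hz)) ⟨hp, hpU⟩ ⟨hq, hqV⟩ hf ?_
  · rw [disjoint_iff_inter_eq_empty, ← hdisj]
    ext
    simp only [mem_inter_iff]
    tauto
  · intro z hz
    by_contra hzY
    simp only [mem_union, not_or] at hzY
    have hzΩ : z ∈ W \ range γ := ⟨not_not.1 hzY.1, hzY.2.1⟩
    exact hz ((hcover hzΩ).imp (fun h => ⟨hzΩ, h⟩) fun h => ⟨hzΩ, h⟩)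
  · rintro z (hz | hz)
    · rw [hfk hz, Complex.exp_add, hc, mul_one, hke z hz]
    · rw [hfg hz, hge z hz]

/-- A sphere in a real normed space of dimension at least two does not embed into `ℝ`. -/
theorem not_injOn_sphere {E : Type*} [NormedAddCommGroup E] [NormedSpace ℝ E]
    (hE : 1 < Module.rank ℝ E) {r : ℝ} (hr : 0 < r) {s : E → ℝ}
    (hs : ContinuousOn s (sphere 0 r)) : ¬ InjOn s (sphere 0 r) := by
  intro hinj
  have : Nontrivial E := (rank_pos_iff_nontrivial (R := ℝ)).1 (zero_lt_one.trans hE)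
  obtain ⟨x, hx⟩ := NormedSpace.sphere_nonempty (x := (0 : E)) (r := r) |>.2 hr.le
  have hneg : ∀ y ∈ sphere (0 : E) r, -y ∈ sphere (0 : E) r := by simp
  have hd : ContinuousOn (fun y => s y - s (-y)) (sphere 0 r) :=
    hs.sub (hs.comp continuous_neg.continuousOn hneg)
  obtain ⟨y, hy, hy0⟩ : (0 : ℝ) ∈ (fun y => s y - s (-y)) '' sphere 0 r := by
    have hpre := (isPreconnected_sphere hE (0 : E) r).image _ hd
    have h1 : s x - s (-x) ∈ (fun y => s y - s (-y)) '' sphere 0 r := ⟨x, hx, rfl⟩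
    have h2 : -(s x - s (-x)) ∈ (fun y => s y - s (-y)) '' sphere 0 r :=
      ⟨-x, hneg x hx, by simp⟩
    rcases le_total 0 (s x - s (-x)) with h | h
    · exact hpre.Icc_subset h2 h1 ⟨by linarith, h⟩
    · exact hpre.Icc_subset h1 h2 ⟨h, by linarith⟩
  have : IsAddTorsionFree E := .of_isTorsionFree ℝ E
  have h3 := self_eq_neg.1 (hinj hy (hneg y hy) (sub_eq_zero.1 hy0))
  rw [h3] at hy
  simp at hy
  exact hr.ne hy

open NNReal in
/-- A ray does not cover the complement of a compact subset of the complex plane. -/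
theorem nonempty_diff_ray {W : Set ℂ} (hK : IsCompact Wᶜ) {γ : ℝ≥0 → ℂ}
    (hγ : Topology.IsClosedEmbedding γ) : (W \ range γ).Nonempty := by
  by_contra! hempty
  rw [sdiff_eq_empty] at hempty
  obtain ⟨R₀, hR₀⟩ := hK.isBounded.exists_norm_le
  have hr : 0 < |R₀| + 1 := by positivity
  obtain ⟨s, hs⟩ := ContinuousMap.exists_extension hγ ⟨fun t : ℝ≥0 => (t : ℝ), by fun_prop⟩
  have hs' : ∀ t, s (γ t) = t := fun t => congrArg (fun f => f t) hs
  refine not_injOn_sphere (E := ℂ) (by simp) hr s.continuous.continuousOn ?_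
  have hsub : sphere (0 : ℂ) (|R₀| + 1) ⊆ range γ := fun z hz => hempty <| by
    by_contra hzW
    have h1 := hR₀ z hzW
    rw [mem_sphere_zero_iff_norm] at hz
    linarith [le_abs_self R₀]
  intro x hx y hy hxy
  obtain ⟨t, rfl⟩ := hsub hx
  obtain ⟨u, rfl⟩ := hsub hy
  rw [hs', hs', NNReal.coe_inj] at hxy
  rw [hxy]

theorem stmt_13 (W : Set Plane) (hWopen : IsOpen W) (hWconn : IsConnected W)
    (hcomp : IsCompact (Wᶜ : Set Plane)) (hint : (interior (Wᶜ : Set Plane)).Nonempty)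
    (γ : ℝ → Plane)
    (hcont : ContinuousOn γ (Ici 0))
    (hinj : InjOn γ (Ici 0))
    (h0 : γ 0 ∈ frontier W)
    (hray : γ '' Ioi 0 ⊆ W)
    (hproper : Tendsto (fun t => ‖γ t‖) atTop atTop) :
    IsConnected (W \ γ '' Ici 0) := by
  let e : Plane ≃ₗᵢ[ℝ] ℂ := Complex.orthonormalBasisOneI.repr.symm
  let δ : NNReal → ℂ := fun t => e (γ t)
  have hlim : Tendsto (fun t => ‖δ t‖) atTop atTop := by
    simpa only [δ, e.norm_map] using! hproper.comp (NNReal.tendsto_coe_atTop.2 tendsto_id)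
  have hδc : Continuous δ :=
    e.continuous.comp (hcont.comp_continuous NNReal.continuous_coe fun t => t.2)
  have hδi : Function.Injective δ := fun t u h =>
    NNReal.coe_injective (hinj t.2 u.2 (e.injective h))
  have hδ : Topology.IsClosedEmbedding δ := by
    refine .of_continuous_injective_isClosedMap hδc hδi
      (isProperMap_iff_tendsto_cocompact.2 ⟨hδc, ?_⟩).isClosedMap
    rwa [cocompact_eq_atTop, ← Metric.cobounded_eq_cocompact, ← tendsto_norm_atTop_iff_cobounded]
  have hrange : e '' (γ '' Ici 0) = range δ := by
    ext z
    constructor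
    · rintro ⟨_, ⟨t, ht, rfl⟩, rfl⟩
      exact ⟨⟨t, ht⟩, rfl⟩
    · rintro ⟨t, rfl⟩
      exact ⟨_, ⟨t, t.2, rfl⟩, rfl⟩
  have hdiff : e '' (W \ γ '' Ici 0) = e '' W \ range δ := by
    rw [image_sdiff e.injective, hrange]
  have hWo : IsOpen (e '' W) := e.toHomeomorph.isOpenMap W hWopen
  have hK : IsCompact (e '' W)ᶜ := by
    rw [← image_compl_eq e.bijective]
    exact hcomp.image e.continuous
  have h0W : δ 0 ∉ e '' W := by
    rintro ⟨x, hx, hxe⟩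
    rw [e.injective hxe] at hx
    rw [hWopen.frontier_eq] at h0
    exact h0.2 hx
  have hpos : ∀ t, 0 < t → δ t ∈ e '' W := fun t ht =>
    ⟨_, hray ⟨t, NNReal.coe_pos.2 ht, rfl⟩, rfl⟩
  have hconn : IsConnected (e '' (W \ γ '' Ici 0)) := by
    rw [hdiff]
    exact ⟨nonempty_diff_ray hK hδ, isPreconnected_diff_ray hWo
      (hWconn.isPreconnected.image _ e.continuous.continuousOn) hK hδ hlim h0W hpos⟩
  exact e.toHomeomorph.isConnected_image.1 hconn
end

section
/- Let V₁, …, Vₙ be finitely many closed topological disks in S² with ⋃ᵢ int Vᵢ connected and S² \ ⋃ᵢ Vᵢ nonempty, and let W be a connected component of S² \ ⋃ᵢ Vᵢ. Then ∂W is homeomorphic to the circle S¹. -/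
open Metric Set

/-- The 2-sphere, as the unit sphere in `ℝ³`. -/
abbrev Sph := Metric.sphere (0 : EuclideanSpace ℝ (Fin 3)) 1

/-- `f` has a continuous logarithm on `S`. -/
def HasLog {X : Type*} [TopologicalSpace X] (f : X → ℂ) (S : Set X) : Prop :=
  ∃ g : X → ℂ, ContinuousOn g S ∧ ∀ z ∈ S, Complex.exp (g z) = f z

theorem HasLog.mono {X : Type*} [TopologicalSpace X] {f : X → ℂ} {S T : Set X}
    (h : HasLog f S) (hTS : T ⊆ S) : HasLog f T :=
  let ⟨g, hg, he⟩ := h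
  ⟨g, hg.mono hTS, fun z hz => he z (hTS hz)⟩

theorem HasLog.congr {X : Type*} [TopologicalSpace X] {f f' : X → ℂ} {S : Set X}
    (h : HasLog f S) (hff : ∀ z ∈ S, f z = f' z) : HasLog f' S :=
  let ⟨g, hg, he⟩ := h
  ⟨g, hg, fun z hz => (he z hz).trans (hff z hz)⟩

theorem hasLog_const {X : Type*} [TopologicalSpace X] {c : ℂ} (hc : c ≠ 0) (S : Set X) :
    HasLog (fun _ => c) S :=
  ⟨fun _ => Complex.log c, continuousOn_const, fun _ _ => Complex.exp_log hc⟩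

theorem HasLog.of_homotopy {X : Type*} [TopologicalSpace X] {S : Set X} {H : ℝ × X → ℂ}
    (hc : ContinuousOn H (Icc 0 1 ×ˢ S)) (hne : ∀ t ∈ Icc (0 : ℝ) 1, ∀ z ∈ S, H (t, z) ≠ 0)
    (h0 : HasLog (fun z => H (0, z)) S) : HasLog (fun z => H (1, z)) S := by
  obtain ⟨g, hg, he⟩ := h0
  let H' : C(unitInterval × S, {z : ℂ // z ≠ 0}) :=
    ⟨fun p => ⟨H (p.1, p.2), hne p.1 p.1.2 p.2 p.2.2⟩, by
      refine Continuous.subtype_mk ?_ _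
      refine hc.comp_continuous (by fun_prop) ?_
      rintro ⟨t, z⟩
      exact ⟨t.2, z.2⟩⟩
  let g' : C(S, ℂ) := ⟨fun z => g z, hg.comp_continuous continuous_subtype_val fun z => z.2⟩
  have key : ∀ a, H' (0, a) = ⟨Complex.exp (g' a), Complex.exp_ne_zero _⟩ := by
    intro a
    apply Subtype.ext
    exact (he a a.2).symm
  let G := Complex.isCoveringMap_exp.liftHomotopy H' g' key
  have hG : ∀ a : S, Complex.exp (G (1, a)) = H (1, a) := by
    intro a
    have := congr_fun (Complex.isCoveringMap_exp.liftHomotopy_lifts H' g' key) (1, a)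
    exact congr_arg Subtype.val this
  classical
  refine ⟨fun z => if h : z ∈ S then G (1, ⟨z, h⟩) else 0, ?_, ?_⟩
  · rw [continuousOn_iff_continuous_domRestrict]
    have : S.domRestrict (fun z => if h : z ∈ S then G (1, ⟨z, h⟩) else 0) = fun a => G (1, a) := by
      ext a
      simp
    rw [this]
    fun_prop
  · intro z hz
    simp only [hz, dif_pos]
    exact hG ⟨z, hz⟩

theorem IsPreconnected.log_eq_add_const {X : Type*} [TopologicalSpace X] {S : Set X}
    (hS : IsPreconnected S) {g₁ g₂ : X → ℂ} (h₁ : ContinuousOn g₁ S) (h₂ : ContinuousOn g₂ S)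
    (he : ∀ z ∈ S, Complex.exp (g₁ z) = Complex.exp (g₂ z)) :
    ∃ c, Complex.exp c = 1 ∧ ∀ z ∈ S, g₁ z = g₂ z + c := by
  rcases S.eq_empty_or_nonempty with rfl | ⟨a, ha⟩
  · exact ⟨0, by simp⟩
  have hc : Complex.exp (g₁ a - g₂ a) = 1 := by
    rw [Complex.exp_sub, he a ha, div_self (Complex.exp_ne_zero _)]
  refine ⟨g₁ a - g₂ a, hc, ?_⟩
  refine Complex.isCoveringMap_exp.eqOn_of_comp_eqOn hS h₁ (h₂.add continuousOn_const) ?_ ha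
    (by simp)
  intro z hz
  simp [Complex.exp_add, hc, he z hz]

theorem ContinuousOn.union_of_closure_inter_subset {X Y : Type*} [TopologicalSpace X]
    [TopologicalSpace Y] {g : X → Y} {A B : Set X} (hA : ContinuousOn g A) (hB : ContinuousOn g B)
    (hAB : closure A ∩ B ⊆ A) (hBA : closure B ∩ A ⊆ B) : ContinuousOn g (A ∪ B) := by
  rintro z (hz | hz)
  · refine continuousWithinAt_union.2 ⟨hA z hz, ?_⟩
    by_cases h : z ∈ closure B
    · exact hB z (hBA ⟨h, hz⟩)
    · exact continuousWithinAt_of_notMem_closure h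
  · refine continuousWithinAt_union.2 ⟨?_, hB z hz⟩
    by_cases h : z ∈ closure A
    · exact hA z (hAB ⟨h, hz⟩)
    · exact continuousWithinAt_of_notMem_closure h

theorem ContinuousOn.congr_add_const_union {X : Type*} [TopologicalSpace X] {f g₁ g₂ : X → ℂ}
    {A B : Set X} (h₁ : ContinuousOn g₁ A) (h₂ : ContinuousOn g₂ B)
    (e₁ : ∀ z ∈ A, Complex.exp (g₁ z) = f z) (e₂ : ∀ z ∈ B, Complex.exp (g₂ z) = f z)
    (hAB : IsPreconnected (A ∩ B)) :
    ∃ g : X → ℂ, ContinuousOn g A ∧ ContinuousOn g B ∧ ∀ z ∈ A ∪ B, Complex.exp (g z) = f z := by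
  classical
  obtain ⟨c, hc, h⟩ := hAB.log_eq_add_const (h₁.mono inter_subset_left) (h₂.mono inter_subset_right)
    fun z hz => (e₁ z hz.1).trans (e₂ z hz.2).symm
  have hB : ∀ z ∈ B, (if z ∈ A then g₁ z else g₂ z + c) = g₂ z + c := by
    intro z hz
    split_ifs with hzA
    · exact h z ⟨hzA, hz⟩
    · rfl
  refine ⟨fun z => if z ∈ A then g₁ z else g₂ z + c, ?_, ?_, ?_⟩
  · exact h₁.congr fun z hz => if_pos hz
  · exact (h₂.add continuousOn_const).congr hB
  · rintro z (hz | hz)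
    · simp only [hz, if_true]
      exact e₁ z hz
    · simp only [hB z hz, Complex.exp_add, hc, mul_one]
      exact e₂ z hz

theorem HasLog.union_of_closure_inter_subset {X : Type*} [TopologicalSpace X] {f : X → ℂ}
    {A B : Set X} (hA : HasLog f A) (hB : HasLog f B) (hAB : IsPreconnected (A ∩ B))
    (h₁ : closure A ∩ B ⊆ A) (h₂ : closure B ∩ A ⊆ B) : HasLog f (A ∪ B) := by
  obtain ⟨g₁, c₁, e₁⟩ := hA
  obtain ⟨g₂, c₂, e₂⟩ := hB
  obtain ⟨g, d₁, d₂, e⟩ := c₁.congr_add_const_union c₂ e₁ e₂ hAB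
  exact ⟨g, d₁.union_of_closure_inter_subset d₂ h₁ h₂, e⟩

theorem HasLog.union_of_isOpen {X : Type*} [TopologicalSpace X] {f : X → ℂ}
    {A B : Set X} (hA : HasLog f A) (hB : HasLog f B) (hAB : IsPreconnected (A ∩ B))
    (h₁ : IsOpen A) (h₂ : IsOpen B) : HasLog f (A ∪ B) := by
  obtain ⟨g₁, c₁, e₁⟩ := hA
  obtain ⟨g₂, c₂, e₂⟩ := hB
  obtain ⟨g, d₁, d₂, e⟩ := c₁.congr_add_const_union c₂ e₁ e₂ hAB
  exact ⟨g, d₁.union_of_isOpen d₂ h₁ h₂, e⟩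

theorem StarConvex.hasLog {E : Type*} [AddCommGroup E] [Module ℝ E] [TopologicalSpace E]
    [ContinuousAdd E] [ContinuousSMul ℝ E] {S : Set E} (hS : StarConvex ℝ 0 S)
    {f : E → ℂ} (hf : ContinuousOn f S) (hne : ∀ z ∈ S, f z ≠ 0) : HasLog f S := by
  rcases S.eq_empty_or_nonempty with rfl | hSne
  · exact ⟨fun _ => 0, by simp⟩
  have h0 : (0 : E) ∈ S := hS.mem hSne
  have hmem : ∀ t ∈ Icc (0 : ℝ) 1, ∀ z ∈ S, t • z ∈ S := fun t ht z hz =>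
    hS.smul_mem hz ht.1 ht.2
  have := HasLog.of_homotopy (S := S) (H := fun p : ℝ × E => f (p.1 • p.2))
    (hf.comp (by fun_prop) fun p hp => hmem _ hp.1 _ hp.2)
    (fun t ht z hz => hne _ (hmem t ht z hz))
    (by simpa using hasLog_const (hne 0 h0) S)
  simpa using this

theorem JoinedIn.hasLog_div {S T : Set ℂ} {p q : ℂ} (h : JoinedIn S p q) (hST : Disjoint S T) :
    HasLog (fun z => (z - p) / (z - q)) T := by
  obtain ⟨γ, hγ⟩ := h.symm
  have hne : ∀ t, ∀ z ∈ T, z - γ t ≠ 0 := fun t z hz h0 =>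
    hST.ne_of_mem (hγ t) hz (sub_eq_zero.1 h0).symm
  have hq : ∀ z ∈ T, z - q ≠ 0 := fun z hz => by simpa using hne 0 z hz
  have := HasLog.of_homotopy (S := T)
    (H := fun x : ℝ × ℂ => (x.2 - γ.extend x.1) / (x.2 - q))
    (by
      refine ContinuousOn.div ?_ (by fun_prop) fun x hx => hq _ hx.2
      exact (continuous_snd.sub (γ.continuous_extend.comp continuous_fst)).continuousOn)
    (fun t ht z hz => div_ne_zero (by simpa [γ.extend_apply ht] using hne ⟨t, ht⟩ z hz) (hq z hz))
    ((hasLog_const one_ne_zero T).congr fun z hz => by simp [div_self (hq z hz)])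
  simpa using this

theorem not_forall_eq_sub_of_le_norm {F : ℂ → ℂ} (hF : Continuous F) (hne : ∀ z, F z ≠ 0) {p : ℂ}
    {R : ℝ} (hR : 0 < R) : ¬ ∀ z, R ≤ ‖z - p‖ → F z = z - p := by
  intro h
  obtain ⟨g, hg, he⟩ := (starConvex_univ (𝕜 := ℝ) (0 : ℂ)).hasLog hF.continuousOn fun z _ => hne z
  rw [continuousOn_univ] at hg
  have hR' : (R : ℂ) ≠ 0 := by exact_mod_cast hR.ne'
  obtain ⟨c, -, hc⟩ := (isPreconnected_univ (α := ℝ)).log_eq_add_const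
    (g₁ := fun θ => g (p + R * Complex.exp (θ * Complex.I)))
    (g₂ := fun θ => Complex.log R + θ * Complex.I)
    (by fun_prop) (by fun_prop) (by
      intro θ _
      rw [he _ (mem_univ _), h _ (by simp [Complex.norm_exp_ofReal_mul_I, abs_of_pos hR]),
        Complex.exp_add, Complex.exp_log hR']
      ring)
  have h0 := hc 0 (mem_univ _)
  have h1 := hc (2 * Real.pi) (mem_univ _)
  simp only [Complex.ofReal_zero, zero_mul, Complex.exp_zero, Complex.ofReal_mul,
    Complex.ofReal_ofNat, Complex.exp_two_pi_mul_I] at h0 h1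
  rw [h0] at h1
  have : (2 * (Real.pi : ℂ) * Complex.I) = 0 := by linear_combination -h1
  exact Complex.two_pi_I_ne_zero this

theorem not_hasLog_div_frontier {Ω : Set ℂ} (hb : Bornology.IsBounded Ω) {p q : ℂ}
    (hp : p ∈ Ω) (hq : q ∉ closure Ω) :
    ¬ HasLog (fun z => (z - p) / (z - q)) (frontier Ω) := by
  classical
  rintro ⟨g, hg, he⟩
  obtain ⟨G, hG⟩ := ContinuousMap.exists_restrict_eq (isClosed_frontier (s := Ω))
    ⟨_, hg.domRestrict⟩
  have hG' : ∀ z ∈ frontier Ω, G z = g z := fun z hz => DFunLike.congr_fun hG ⟨z, hz⟩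
  obtain ⟨R, hR, hRb⟩ := hb.closure.subset_ball_lt 0 p
  have hcont : Continuous ((closure Ω).piecewise (fun z => (z - q) * Complex.exp (G z))
      (fun z => z - p)) := by
    refine Continuous.piecewise ?_ (by fun_prop) (by fun_prop)
    intro z hz
    have hz' : z ∈ frontier Ω := frontier_closure_subset hz
    have hzq : z - q ≠ 0 := fun h => hq (by
      rw [← sub_eq_zero.1 h]; exact frontier_subset_closure hz')
    rw [hG' z hz', he z hz']
    field_simp
  refine not_forall_eq_sub_of_le_norm hcont ?_ hR (p := p) ?_
  · intro z
    by_cases hz : z ∈ closure Ω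
    · rw [piecewise_eq_of_mem _ _ _ hz]
      refine mul_ne_zero (fun h => hq ?_) (Complex.exp_ne_zero _)
      rwa [← sub_eq_zero.1 h]
    · rw [piecewise_eq_of_notMem _ _ _ hz]
      intro h
      rw [sub_eq_zero.1 h] at hz
      exact hz (subset_closure hp)
  · intro z hz
    refine piecewise_eq_of_notMem _ _ _ fun h => ?_
    have := hRb h
    rw [mem_ball, dist_eq_norm] at this
    linarith

theorem not_hasLog_div_compl_pair {a b : ℂ} (hab : a ≠ b) :
    ¬ HasLog (fun z => (z - a) / (z - b)) {a, b}ᶜ := by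
  intro h
  have hd : 0 < dist b a := dist_pos.2 hab.symm
  have hr : dist b a / 2 ≠ 0 := by positivity
  refine not_hasLog_div_frontier (Ω := ball a (dist b a / 2)) isBounded_ball
    (mem_ball_self (by positivity)) (q := b) ?_ (h.mono ?_)
  · rw [closure_ball _ hr, mem_closedBall]
    linarith
  · rw [frontier_ball _ hr]
    rintro z hz (rfl | rfl)
    · rw [mem_sphere, dist_self] at hz
      linarith
    · rw [mem_sphere] at hz
      linarith

theorem isPreconnected_setOf_lt_norm {R : ℝ} (hR : 0 < R) : IsPreconnected {z : ℂ | R < ‖z‖} := by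
  have h : {z : ℂ | R < ‖z‖} = Complex.exp '' (Complex.re ⁻¹' Ioi (Real.log R)) := by
    ext z
    constructor
    · intro hz
      have hz0 : 0 < ‖z‖ := hR.trans hz
      refine ⟨Complex.log z, ?_, Complex.exp_log (norm_pos_iff.1 hz0)⟩
      simpa [Complex.log_re] using Real.log_lt_log hR hz
    · rintro ⟨w, hw, rfl⟩
      rw [mem_ofPred_eq, Complex.norm_exp]
      exact (Real.log_lt_iff_lt_exp hR).1 hw
  rw [h]
  refine IsPreconnected.image (Convex.isPreconnected ?_) _ Complex.continuous_exp.continuousOn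
  exact (convex_Ioi _).linear_preimage Complex.reLm

theorem isPreconnected_ball_diff_center (x : ℂ) {r : ℝ} (hr : 0 < r) :
    IsPreconnected (ball x r \ {x}) := by
  have h : ball x r \ {x} = (fun w => x + Complex.exp w) '' (Complex.re ⁻¹' Iio (Real.log r)) := by
    ext z
    constructor
    · rintro ⟨hz, hzx⟩
      have hz0 : 0 < ‖z - x‖ := norm_pos_iff.2 (sub_ne_zero.2 hzx)
      refine ⟨Complex.log (z - x), ?_, ?_⟩
      · rw [mem_ball, dist_eq_norm] at hz
        simpa [Complex.log_re] using Real.log_lt_log hz0 hz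
      · simp [Complex.exp_log (norm_pos_iff.1 hz0)]
    · rintro ⟨w, hw, rfl⟩
      refine ⟨?_, by simp [Complex.exp_ne_zero]⟩
      rw [mem_ball, dist_eq_norm, add_sub_cancel_left, Complex.norm_exp]
      exact (Real.lt_log_iff_exp_lt hr).1 hw
  rw [h]
  refine IsPreconnected.image (Convex.isPreconnected ?_) _ (by fun_prop)
  exact (convex_Iio _).linear_preimage Complex.reLm

theorem IsPreconnected.diff_singleton_of_mem_nhds {X : Type*} [TopologicalSpace X] [T1Space X]
    {U N : Set X} {x : X} (hU : IsPreconnected U) (hN : N ∈ nhds x) (hNU : N ⊆ U)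
    (hNc : IsPreconnected (N \ {x})) : IsPreconnected (U \ {x}) := by
  have hcompl : IsOpen ({x}ᶜ : Set X) := isOpen_compl_singleton
  have key : ∀ u v : Set X, IsOpen u → IsOpen v → U \ {x} ⊆ u ∪ v →
      (U \ {x} ∩ u).Nonempty → (U \ {x} ∩ v).Nonempty → N \ {x} ⊆ u →
      (U \ {x} ∩ (u ∩ v)).Nonempty := by
    intro u v hu hv huv hun hvn hNu
    have hopen : IsOpen (insert x (u \ {x})) := by
      rw [isOpen_iff_mem_nhds]
      rintro z (rfl | hz)
      · filter_upwards [hN] with w hw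
        by_cases hwz : w = z
        · exact Or.inl hwz
        · exact Or.inr ⟨hNu ⟨hw, hwz⟩, hwz⟩
      · exact Filter.mem_of_superset ((hu.sdiff isClosed_singleton).mem_nhds hz)
          (subset_insert _ _)
    obtain ⟨z, hzU, hz, hzv⟩ := hU _ (v \ {x}) hopen (hv.sdiff isClosed_singleton)
      (by
        intro z hz
        by_cases hzx : z = x
        · exact Or.inl (Or.inl hzx)
        · rcases huv ⟨hz, hzx⟩ with h | h
          · exact Or.inl (Or.inr ⟨h, hzx⟩)
          · exact Or.inr ⟨h, hzx⟩)
      (hun.mono fun z hz => ⟨hz.1.1, Or.inr ⟨hz.2, hz.1.2⟩⟩)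
      (hvn.mono fun z hz => ⟨hz.1.1, hz.2, hz.1.2⟩)
    rcases hz with rfl | hz
    · exact absurd rfl hzv.2
    · exact ⟨z, ⟨hzU, hz.2⟩, hz.1, hzv.1⟩
  intro u v hu hv huv hun hvn
  have hsub : N \ {x} ⊆ U \ {x} := sdiff_subset_sdiff_left hNU
  by_cases h : (N \ {x} ∩ u).Nonempty ∧ (N \ {x} ∩ v).Nonempty
  · exact (hNc u v hu hv (hsub.trans huv) h.1 h.2).mono (inter_subset_inter_left _ hsub)
  · rcases not_and_or.1 h with h | h
    · rw [inter_comm u v]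
      refine key v u hv hu (by rwa [union_comm]) hvn hun fun z hz => ?_
      exact (huv (hsub hz)).resolve_left fun hzu => h ⟨z, hz, hzu⟩
    · refine key u v hu hv huv hun hvn fun z hz => ?_
      exact (huv (hsub hz)).resolve_right fun hzu => h ⟨z, hz, hzu⟩

theorem IsOpen.isPreconnected_diff_singleton {U : Set ℂ} (ho : IsOpen U) (hU : IsPreconnected U)
    (x : ℂ) : IsPreconnected (U \ {x}) := by
  by_cases hx : x ∈ U
  · obtain ⟨r, hr, hrU⟩ := Metric.isOpen_iff.1 ho x hx
    exact hU.diff_singleton_of_mem_nhds (ball_mem_nhds x hr) hrU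
      (isPreconnected_ball_diff_center x hr)
  · rwa [sdiff_singleton_eq_self hx]

theorem frontier_connectedComponentIn_subset {X : Type*} [TopologicalSpace X]
    [LocallyConnectedSpace X] {F : Set X} (hF : IsOpen F) (x : X) :
    frontier (connectedComponentIn F x) ⊆ Fᶜ := by
  intro y hy hyF
  have ho : IsOpen (connectedComponentIn F x) := hF.connectedComponentIn
  rw [ho.frontier_eq] at hy
  obtain ⟨z, hzy, hzx⟩ := mem_closure_iff.1 hy.1 _ (hF.connectedComponentIn (x := y))
    (mem_connectedComponentIn hyF)
  apply hy.2
  rw [connectedComponentIn_eq hzx, ← connectedComponentIn_eq hzy]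
  exact mem_connectedComponentIn hyF

theorem mem_connectedComponentIn_of_hasLog {K : Set ℂ} (hK : IsClosed K) {p q : ℂ} (hp : p ∉ K)
    (hq : q ∉ K) (hb : Bornology.IsBounded (connectedComponentIn Kᶜ p))
    (h : HasLog (fun z => (z - p) / (z - q)) K) : q ∈ connectedComponentIn Kᶜ p := by
  by_contra hqc
  have hf := frontier_connectedComponentIn_subset hK.isOpen_compl p
  rw [compl_compl] at hf
  refine not_hasLog_div_frontier hb (mem_connectedComponentIn hp) (q := q) ?_ (h.mono hf)
  rw [closure_eq_self_union_frontier]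
  rintro (h | h)
  · exact hqc h
  · exact hq (hf h)

theorem IsCompact.isPreconnected_compl_of_hasLog {K : Set ℂ} (hK : IsCompact K)
    (h : ∀ p ∉ K, ∀ q ∉ K, HasLog (fun z => (z - p) / (z - q)) K) : IsPreconnected Kᶜ := by
  obtain ⟨R, hR, hKR⟩ := hK.isBounded.subset_ball_lt 0 0
  have hout : {z : ℂ | R < ‖z‖} ⊆ Kᶜ := fun z hz hzK => by
    have := hKR hzK
    rw [mem_ball_zero_iff] at this
    exact lt_asymm this hz
  have hunb : ∀ p, ¬ Bornology.IsBounded (connectedComponentIn Kᶜ p) →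
      (connectedComponentIn Kᶜ p ∩ {z : ℂ | R < ‖z‖}).Nonempty := by
    intro p hp
    by_contra hne
    refine hp ((isBounded_closedBall (x := (0 : ℂ)) (r := R)).subset fun z hz => ?_)
    rw [mem_closedBall_zero_iff]
    exact not_lt.1 fun hlt => hne ⟨z, hz, hlt⟩
  refine isPreconnected_of_forall_pair fun p hp q hq => ?_
  suffices q ∈ connectedComponentIn Kᶜ p from
    ⟨_, connectedComponentIn_subset _ _, mem_connectedComponentIn hp, this,
      isPreconnected_connectedComponentIn⟩
  by_cases hbp : Bornology.IsBounded (connectedComponentIn Kᶜ p)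
  · exact mem_connectedComponentIn_of_hasLog hK.isClosed hp hq hbp (h p hp q hq)
  by_cases hbq : Bornology.IsBounded (connectedComponentIn Kᶜ q)
  · have := mem_connectedComponentIn_of_hasLog hK.isClosed hq hp hbq (h q hq p hp)
    rw [← connectedComponentIn_eq this]
    exact mem_connectedComponentIn hq
  obtain ⟨z, hz, hzR⟩ := hunb p hbp
  obtain ⟨w, hw, hwR⟩ := hunb q hbq
  have hzw : w ∈ connectedComponentIn Kᶜ z :=
    (isPreconnected_setOf_lt_norm hR).subset_connectedComponentIn hzR hout hwR
  rw [connectedComponentIn_eq hz, connectedComponentIn_eq hzw, ← connectedComponentIn_eq hw]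
  exact mem_connectedComponentIn hq

theorem IsCompact.continuousOn_invFunOn {X Y : Type*} [TopologicalSpace X] [TopologicalSpace Y]
    [T2Space Y] [Nonempty X] {K : Set X} (hK : IsCompact K) {f : X → Y} (hf : ContinuousOn f K)
    (hi : InjOn f K) : ContinuousOn (Function.invFunOn f K) (f '' K) := by
  rw [continuousOn_iff_isClosed]
  intro t ht
  refine ⟨f '' (K ∩ t), ((hK.inter_right ht).image_of_continuousOn
    (hf.mono inter_subset_left)).isClosed, ?_⟩
  ext y
  constructor
  · rintro ⟨hyt, x, hx, rfl⟩
    rw [mem_preimage, hi.leftInvOn_invFunOn hx] at hyt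
    exact ⟨⟨x, ⟨hx, hyt⟩, rfl⟩, x, hx, rfl⟩
  · rintro ⟨⟨x, ⟨hx, hxt⟩, rfl⟩, -⟩
    refine ⟨?_, x, hx, rfl⟩
    rwa [mem_preimage, hi.leftInvOn_invFunOn hx]

theorem isPreconnected_compl_image_closedBall {φ : ℂ → ℂ} (hc : ContinuousOn φ (closedBall 0 1))
    (hi : InjOn φ (closedBall 0 1)) : IsPreconnected (φ '' closedBall 0 1)ᶜ := by
  have hK := isCompact_closedBall (0 : ℂ) 1
  refine (hK.image_of_continuousOn hc).isPreconnected_compl_of_hasLog fun p hp q hq => ?_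
  have hne : ∀ p ∉ φ '' closedBall 0 1, ∀ z ∈ closedBall (0 : ℂ) 1, φ z - p ≠ 0 :=
    fun p hp z hz h => hp ⟨z, hz, sub_eq_zero.1 h⟩
  obtain ⟨g, hg, he⟩ := (((convex_closedBall (0 : ℂ) 1).starConvex
    (mem_closedBall_self zero_le_one)).hasLog (f := fun z => (φ z - p) / (φ z - q))
    ((hc.sub continuousOn_const).div (hc.sub continuousOn_const) (hne q hq))
    fun z hz => div_ne_zero (hne p hp z hz) (hne q hq z hz))
  have hmaps : MapsTo (Function.invFunOn φ (closedBall 0 1)) (φ '' closedBall 0 1)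
      (closedBall 0 1) := fun y hy => Function.invFunOn_mem hy
  refine ⟨fun y => g (Function.invFunOn φ (closedBall 0 1) y),
    hg.comp (hK.continuousOn_invFunOn hc hi) hmaps, fun y hy => ?_⟩
  simp only [he _ (hmaps hy), Function.invFunOn_eq hy]

theorem not_isPreconnected_compl_image_sphere {φ : ℂ → ℂ} (hc : ContinuousOn φ (sphere 0 1))
    (hi : InjOn φ (sphere 0 1)) : ¬ IsPreconnected (φ '' sphere 0 1)ᶜ := by
  intro h
  have arc : ∀ s : ℝ, s ^ 2 = 1 → JoinedIn (φ '' (sphere 0 1 ∩ {z : ℂ | 0 ≤ s * z.im}))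
      (φ 1) (φ (-1)) := by
    intro s hs
    have hmem : ∀ t ∈ Icc (0 : ℝ) 1, Complex.exp ((s * Real.pi * t : ℝ) * Complex.I) ∈
        sphere (0 : ℂ) 1 ∩ {z : ℂ | 0 ≤ s * z.im} := by
      intro t ht
      refine ⟨by rw [mem_sphere_zero_iff_norm, Complex.norm_exp_ofReal_mul_I], ?_⟩
      rw [mem_ofPred_eq, Complex.exp_ofReal_mul_I_im]
      have hsin : 0 ≤ Real.sin (Real.pi * t) :=
        Real.sin_nonneg_of_nonneg_of_le_pi (mul_nonneg Real.pi_pos.le ht.1)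
          (mul_le_of_le_one_right Real.pi_pos.le ht.2)
      rcases mul_self_eq_one_iff.1 ((sq _).symm.trans hs) with rfl | rfl
      · simpa using hsin
      · simpa using hsin
    refine JoinedIn.ofLine (f := fun t : ℝ => φ (Complex.exp ((s * Real.pi * t : ℝ) * Complex.I)))
      ?_ (by simp) ?_ ?_
    · exact hc.comp (by fun_prop) fun t ht => (hmem t ht).1
    · have : Complex.exp ((s * Real.pi * (1 : ℝ) : ℝ) * Complex.I) = -1 := by
        rcases mul_self_eq_one_iff.1 ((sq _).symm.trans hs) with rfl | rfl
        · simp [Complex.exp_pi_mul_I]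
        · simp [Complex.exp_neg, Complex.exp_pi_mul_I]
      simp only [this]
    · rintro _ ⟨t, ht, rfl⟩
      exact ⟨_, hmem t ht, rfl⟩
  have hK := isCompact_sphere (0 : ℂ) 1
  have hcl : ∀ s : ℝ, IsClosed (φ '' (sphere 0 1 ∩ {z : ℂ | 0 ≤ s * z.im})) := fun s =>
    ((hK.inter_right (isClosed_le (by fun_prop) (by fun_prop))).image_of_continuousOn
      (hc.mono inter_subset_left)).isClosed
  have h1 : (1 : ℂ) ∈ sphere (0 : ℂ) 1 := by simp
  have h2 : (-1 : ℂ) ∈ sphere (0 : ℂ) 1 := by simp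
  have hne : φ 1 ≠ φ (-1) := fun h => by
    have := hi h1 h2 h
    norm_num at this
  have l₁ := (arc 1 (by norm_num)).hasLog_div disjoint_compl_right
  have l₂ := (arc (-1) (by norm_num)).hasLog_div disjoint_compl_right
  refine not_hasLog_div_compl_pair hne ((l₁.union_of_isOpen l₂ ?_ (hcl 1).isOpen_compl
    (hcl (-1)).isOpen_compl).mono ?_)
  · convert h using 1
    rw [← compl_union, ← image_union, ← inter_union_distrib_left]
    congr 2
    ext z
    simp only [mem_inter_iff, mem_union, mem_ofPred_eq, and_iff_left_iff_imp]
    intro _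
    rcases le_total 0 z.im with h | h
    · left; linarith
    · right; linarith
  · rw [← compl_inter, compl_subset_compl]
    rintro _ ⟨⟨z, ⟨hz, hz1⟩, rfl⟩, w, ⟨hw, hw1⟩, hwz⟩
    obtain rfl := hi hw hz hwz
    simp only [mem_ofPred_eq] at hz1 hw1
    have him : w.im = 0 := by linarith
    have hn : w.re ^ 2 = 1 := by
      have := mem_sphere_zero_iff_norm.1 hz
      rw [← sq_eq_sq₀ (norm_nonneg _) zero_le_one, Complex.sq_norm, Complex.normSq_apply, him]
        at this
      linarith
    rcases mul_self_eq_one_iff.1 ((sq _).symm.trans hn) with h | h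
    · left
      congr 1
      exact Complex.ext h him
    · right
      rw [mem_singleton_iff]
      congr 1
      exact Complex.ext (by simpa using h) (by simpa using him)

theorem isOpen_image_ball {φ : ℂ → ℂ} (hc : ContinuousOn φ (closedBall 0 1))
    (hi : InjOn φ (closedBall 0 1)) : IsOpen (φ '' ball 0 1) := by
  have hsub : sphere (0 : ℂ) 1 ⊆ closedBall 0 1 := sphere_subset_closedBall
  have hns := not_isPreconnected_compl_image_sphere (hc.mono hsub) (hi.mono hsub)
  have hcl : IsOpen (φ '' sphere 0 1)ᶜ :=
    ((isCompact_sphere (0 : ℂ) 1).image_of_continuousOn (hc.mono hsub)).isClosed.isOpen_compl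
  have hout := isPreconnected_compl_image_closedBall hc hi
  have hin : IsPreconnected (φ '' ball 0 1) :=
    isPreconnected_ball.image _ (hc.mono ball_subset_closedBall)
  have hunion : (φ '' sphere 0 1)ᶜ = φ '' ball 0 1 ∪ (φ '' closedBall 0 1)ᶜ := by
    ext y
    constructor
    · intro hy
      by_cases hyb : y ∈ φ '' closedBall 0 1
      · obtain ⟨z, hz, rfl⟩ := hyb
        rw [← ball_union_sphere] at hz
        rcases hz with hz | hz
        · exact Or.inl ⟨z, hz, rfl⟩
        · exact absurd ⟨z, hz, rfl⟩ hy
      · exact Or.inr hyb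
    · rintro (⟨z, hz, rfl⟩ | hy)
      · rintro ⟨w, hw, hwz⟩
        rw [hi (hsub hw) (ball_subset_closedBall hz) hwz] at hw
        exact (mem_ball.1 hz).ne hw
      · exact fun h => hy (image_mono hsub h)
  have h0 : φ 0 ∈ φ '' ball 0 1 := ⟨0, mem_ball_self one_pos, rfl⟩
  have hsubin : φ '' ball 0 1 ⊆ connectedComponentIn (φ '' sphere 0 1)ᶜ (φ 0) :=
    hin.subset_connectedComponentIn h0 (hunion ▸ subset_union_left)
  suffices connectedComponentIn (φ '' sphere 0 1)ᶜ (φ 0) ⊆ φ '' ball 0 1 by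
    rw [hsubin.antisymm this]
    exact hcl.connectedComponentIn
  intro y hy
  by_contra hyn
  have hy' : y ∈ (φ '' closedBall 0 1)ᶜ :=
    (hunion ▸ connectedComponentIn_subset _ _ hy : y ∈ φ '' ball 0 1 ∪ _).resolve_left hyn
  have hsubout : (φ '' closedBall 0 1)ᶜ ⊆ connectedComponentIn (φ '' sphere 0 1)ᶜ (φ 0) := by
    rw [connectedComponentIn_eq hy]
    exact hout.subset_connectedComponentIn hy' (hunion ▸ subset_union_right)
  apply hns
  have : (φ '' sphere 0 1)ᶜ = connectedComponentIn (φ '' sphere 0 1)ᶜ (φ 0) := by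
    refine subset_antisymm ?_ (connectedComponentIn_subset _ _)
    conv_lhs => rw [hunion]
    exact union_subset hsubin hsubout
  rw [this]
  exact isPreconnected_connectedComponentIn

theorem IsPreconnected.inter_frontier_nonempty {X : Type*} [TopologicalSpace X] {S t : Set X}
    (hS : IsPreconnected S) (h₁ : (S ∩ t).Nonempty) (h₂ : (S ∩ tᶜ).Nonempty) :
    (S ∩ frontier t).Nonempty := by
  by_contra hne
  have hdis : ∀ z ∈ S, z ∉ frontier t := fun z hz hzf => hne ⟨z, hz, hzf⟩
  have hmem : ∀ z ∈ S, z ∈ t → z ∈ interior t := fun z hz hzt => by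
    by_contra h
    exact hdis z hz ⟨subset_closure hzt, h⟩
  have hnot : ∀ z ∈ S, z ∉ t → z ∈ (closure t)ᶜ := fun z hz hzt h =>
    hdis z hz ⟨h, fun hi => hzt (interior_subset hi)⟩
  obtain ⟨a, ha, hat⟩ := h₁
  obtain ⟨b, hb, hbt⟩ := h₂
  obtain ⟨z, -, hz, hz'⟩ :=
    hS (interior t) (closure t)ᶜ isOpen_interior isClosed_closure.isOpen_compl
    (fun z hz => (em (z ∈ t)).imp (hmem z hz) (hnot z hz)) ⟨a, ha, hmem a ha hat⟩
    ⟨b, hb, hnot b hb hbt⟩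
  exact hz' (subset_closure (interior_subset hz))

theorem not_isPreconnected_frontier_diff_pair {W U : Set ℂ} (hW : IsOpen W) {x y : ℂ} (hxy : x ≠ y)
    (hUW : Disjoint U (closure W)) (hjW : JoinedIn (W ∪ {x, y}) x y)
    (hjU : JoinedIn (U ∪ {x, y}) x y) :
    ¬ IsPreconnected (frontier W \ {x, y}) := by
  intro h
  have l₁ : HasLog (fun z => (z - x) / (z - y)) (closure W \ {x, y}) :=
    hjU.hasLog_div (disjoint_union_left.2
      ⟨hUW.mono_right sdiff_subset, disjoint_sdiff_right⟩)
  have l₂ : HasLog (fun z => (z - x) / (z - y)) (Wᶜ \ {x, y}) :=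
    hjW.hasLog_div (disjoint_union_left.2
      ⟨disjoint_compl_right.mono_right sdiff_subset, disjoint_sdiff_right⟩)
  refine not_hasLog_div_compl_pair hxy ((l₁.union_of_closure_inter_subset l₂ ?_ ?_ ?_).mono ?_)
  · convert h using 1
    rw [hW.frontier_eq]
    ext z
    simp only [mem_inter_iff, mem_sdiff, mem_compl_iff]
    tauto
  · rintro z ⟨hz, -, hz'⟩
    exact ⟨closure_minimal sdiff_subset isClosed_closure hz, hz'⟩
  · rintro z ⟨hz, -, hz'⟩
    exact ⟨closure_minimal sdiff_subset hW.isClosed_compl hz, hz'⟩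
  · intro z hz
    by_cases hzW : z ∈ W
    · exact Or.inl ⟨subset_closure hzW, hz⟩
    · exact Or.inr ⟨hzW, hz⟩

theorem hasLog_compl_singleton_of_eq_one {f : ℂ → ℂ} {x : ℂ} {R : ℝ} (hf : ContinuousOn f {x}ᶜ)
    (hne : ∀ z ≠ x, f z ≠ 0) (h1 : ∀ z, R ≤ ‖z‖ → f z = 1) : HasLog f {x}ᶜ := by
  classical
  let F : ℂ → ℂ := fun w => if w = 0 then 1 else f (x + w⁻¹)
  have hF : Continuous F := by
    rw [continuous_iff_continuousAt]
    intro w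
    by_cases hw : w = 0
    · subst hw
      have hev : F =ᶠ[nhds 0] fun _ => 1 := by
        have hpos : (0 : ℝ) < (|R| + ‖x‖ + 1)⁻¹ := by positivity
        filter_upwards [ball_mem_nhds (0 : ℂ) hpos] with w hw
        by_cases hw0 : w = 0
        · simp [F, hw0]
        · simp only [F, hw0, if_false]
          apply h1
          have hwn : 0 < ‖w‖ := norm_pos_iff.2 hw0
          rw [mem_ball_zero_iff] at hw
          have h2 : |R| + ‖x‖ + 1 < ‖w⁻¹‖ := by
            rw [norm_inv]
            exact (lt_inv_comm₀ (by positivity) hwn).2 hw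
          have h3 : ‖w⁻¹‖ ≤ ‖x + w⁻¹‖ + ‖x‖ := by
            calc ‖w⁻¹‖ = ‖(x + w⁻¹) - x‖ := by ring_nf
              _ ≤ _ := norm_sub_le _ _
          linarith [le_abs_self R]
      exact continuousAt_const.congr hev.symm
    · have hev : F =ᶠ[nhds w] fun w => f (x + w⁻¹) := by
        filter_upwards [isOpen_ne.mem_nhds hw] with v hv
        exact if_neg hv
      refine ContinuousAt.congr ?_ hev.symm
      refine ContinuousAt.comp (f := fun w : ℂ => x + w⁻¹) (g := f) ?_ ?_
      · exact hf.continuousAt (isOpen_compl_singleton.mem_nhds (by simpa using hw))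
      · exact continuousAt_const.add (continuousAt_inv₀ hw)
  obtain ⟨g, hg, he⟩ := (starConvex_univ (𝕜 := ℝ) (0 : ℂ)).hasLog hF.continuousOn (by
    intro w _
    by_cases hw : w = 0
    · simp [F, hw]
    · simp only [F, hw, if_false]
      exact hne _ (by simpa using hw))
  rw [continuousOn_univ] at hg
  refine ⟨fun z => g ((z - x)⁻¹), ?_, ?_⟩
  · exact hg.comp_continuousOn ((continuousOn_id.sub continuousOn_const).inv₀ fun z hz =>
      sub_ne_zero.2 hz)
  · intro z hz
    have hzx : z - x ≠ 0 := sub_ne_zero.2 hz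
    simp [he _ (mem_univ _), F, hzx]

theorem isPreconnected_frontier_diff_singleton {W : Set ℂ} {x : ℂ} {R : ℝ} (hW : IsOpen W)
    (hWR : ∀ z, R ≤ ‖z‖ → z ∈ W) (h₁ : IsPreconnected (closure W \ {x}))
    (h₂ : IsPreconnected (Wᶜ \ {x})) : IsPreconnected (frontier W \ {x}) := by
  classical
  rw [isPreconnected_closed_iff]
  intro t t' ht ht' hsub hC hD
  by_contra hne
  have hfc : IsClosed (frontier W) := isClosed_frontier
  set C := (frontier W \ {x}) ∩ t with hCdef
  set D := (frontier W \ {x}) ∩ t' with hDdef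
  have hclC : closure C ⊆ frontier W ∩ t :=
    closure_minimal (fun z hz => ⟨hz.1.1, hz.2⟩) (hfc.inter ht)
  have hclD : closure D ⊆ frontier W ∩ t' :=
    closure_minimal (fun z hz => ⟨hz.1.1, hz.2⟩) (hfc.inter ht')
  have hout : IsClosed {z : ℂ | R ≤ ‖z‖} := isClosed_le (by fun_prop) (by fun_prop)
  have hfR : ∀ z ∈ frontier W, ¬ R ≤ ‖z‖ := fun z hz hzR => by
    rw [hW.frontier_eq] at hz
    exact hz.2 (hWR z hzR)
  set C' := C ∪ {z : ℂ | R ≤ ‖z‖} with hC'def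
  have hC' : C'.Nonempty := hC.mono subset_union_left
  have hpos : ∀ z ≠ x, 0 < infDist z C' + infDist z D := by
    intro z hz
    by_contra hle
    have i1 : 0 ≤ infDist z C' := infDist_nonneg
    have i2 : 0 ≤ infDist z D := infDist_nonneg
    have e1 : infDist z C' = 0 := by linarith
    have e2 : infDist z D = 0 := by linarith
    rw [← mem_closure_iff_infDist_zero hC', hC'def, closure_union, hout.closure_eq] at e1
    rw [← mem_closure_iff_infDist_zero hD] at e2
    have hzD := hclD e2
    rcases e1 with e1 | e1
    · exact hne ⟨z, ⟨hzD.1, hz⟩, (hclC e1).2, hzD.2⟩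
    · exact hfR z hzD.1 e1
  let u : ℂ → ℝ := fun z => infDist z C' / (infDist z C' + infDist z D)
  have hu : ContinuousOn u {x}ᶜ :=
    (continuous_infDist_pt C').continuousOn.div
      ((continuous_infDist_pt C').add (continuous_infDist_pt D)).continuousOn
      fun z hz => (hpos z hz).ne'
  have huC : ∀ z ∈ C', u z = 0 := fun z hz => by simp [u, infDist_zero_of_mem hz]
  have huD : ∀ z ∈ D, u z = 1 := fun z hz => by
    have := hpos z hz.1.2
    simp only [u, infDist_zero_of_mem hz, add_zero] at this ⊢
    exact div_self this.ne'
  let l : ℂ → ℂ := fun z => 2 * Real.pi * Complex.I * u z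
  have hl : ContinuousOn l {x}ᶜ := continuousOn_const.mul
    (Complex.continuous_ofReal.comp_continuousOn hu)
  let f : ℂ → ℂ := fun z => if z ∈ closure W then Complex.exp (l z) else 1
  have f₁ : ∀ z ∈ closure W \ {x}, f z = Complex.exp (l z) := fun z hz => if_pos hz.1
  have f₂ : ∀ z ∈ Wᶜ \ {x}, f z = 1 := by
    intro z hz
    by_cases hzc : z ∈ closure W
    · have hzf : z ∈ frontier W \ {x} := by
        rw [hW.frontier_eq]
        exact ⟨⟨hzc, hz.1⟩, hz.2⟩
      simp only [f, hzc, if_true, l]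
      rcases hsub hzf with h | h
      · simp [huC z (Or.inl ⟨hzf, h⟩)]
      · simp [huD z ⟨hzf, h⟩, Complex.exp_two_pi_mul_I]
    · exact if_neg hzc
  have hunion : (closure W \ {x}) ∪ (Wᶜ \ {x}) = {x}ᶜ := by
    ext z
    have := @subset_closure _ _ W z
    simp only [mem_union, mem_sdiff, mem_compl_iff, mem_singleton_iff]
    tauto
  have hf : ContinuousOn f {x}ᶜ := by
    rw [← hunion]
    refine ContinuousOn.union_of_closure_inter_subset ?_ ?_ ?_ ?_
    · exact (Complex.continuous_exp.comp_continuousOn (hl.mono fun z hz => hz.2)).congr f₁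
    · exact continuousOn_const.congr f₂
    · rintro z ⟨hz, -, hz'⟩
      exact ⟨closure_minimal sdiff_subset isClosed_closure hz, hz'⟩
    · rintro z ⟨hz, -, hz'⟩
      exact ⟨closure_minimal sdiff_subset hW.isClosed_compl hz, hz'⟩
  obtain ⟨g, hg, he⟩ := hasLog_compl_singleton_of_eq_one (R := R) hf
    (by
      intro z _
      by_cases hz : z ∈ closure W
      · simp [f, hz, Complex.exp_ne_zero]
      · simp [f, hz])
    (by
      intro z hz
      simp [f, subset_closure (hWR z hz), l, huC z (Or.inr hz)])
  obtain ⟨c₁, -, hc₁⟩ := h₁.log_eq_add_const (hg.mono fun z hz => hz.2)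
    (hl.mono fun z hz => hz.2) fun z hz => (he z hz.2).trans (f₁ z hz)
  obtain ⟨c₂, -, hc₂⟩ := h₂.log_eq_add_const (g₂ := fun _ => 0) (hg.mono fun z hz => hz.2)
    continuousOn_const fun z hz => by rw [he z hz.2, f₂ z hz, Complex.exp_zero]
  have key : ∀ z ∈ frontier W \ {x}, l z + c₁ = c₂ := by
    intro z hz
    rw [hW.frontier_eq] at hz
    rw [← hc₁ z ⟨hz.1.1, hz.2⟩, hc₂ z ⟨hz.1.2, hz.2⟩, zero_add]
  obtain ⟨p, hp⟩ := hC
  obtain ⟨q, hq⟩ := hD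
  have kp := key p hp.1
  have kq := key q hq.1
  simp only [l, huC p (Or.inl hp), huD q hq, Complex.ofReal_zero, Complex.ofReal_one] at kp kq
  exact Complex.two_pi_I_ne_zero (by linear_combination kq - kp)

theorem isPreconnected_compl_diff_singleton {V W : Set ℂ} {x : ℂ} (hV : IsClosed V)
    (hVx : IsPreconnected (V \ {x})) (hne : (V \ {x}).Nonempty) (hxV : x ∈ V) (hW : IsOpen W)
    (hWne : W.Nonempty) (hWV : Disjoint W V) (hfW : frontier W ⊆ V) :
    IsPreconnected (Wᶜ \ {x}) := by
  obtain ⟨v, hv⟩ := hne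
  have hVW : V ⊆ Wᶜ := hWV.subset_compl_left
  refine isPreconnected_of_forall v fun z hz => ?_
  by_cases hzV : z ∈ V
  · exact ⟨V \ {x}, sdiff_subset_sdiff_left hVW, hv, ⟨hzV, hz.2⟩, hVx⟩
  set Ω := connectedComponentIn Vᶜ z with hΩ
  have hzΩ : z ∈ Ω := mem_connectedComponentIn hzV
  have hΩo : IsOpen Ω := hV.isOpen_compl.connectedComponentIn
  have hΩV : Ω ⊆ Vᶜ := connectedComponentIn_subset _ _
  have hfΩ : frontier Ω ⊆ V := by
    simpa using frontier_connectedComponentIn_subset hV.isOpen_compl z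
  have hΩc : IsPreconnected Ω := isPreconnected_connectedComponentIn
  have hΩW : Disjoint Ω W := by
    rw [Set.disjoint_left]
    intro w hwΩ hwW
    have hsub : Ω ⊆ W := by
      by_contra hns
      obtain ⟨y, hy, hyf⟩ := hΩc.inter_frontier_nonempty ⟨w, hwΩ, hwW⟩
        (inter_compl_nonempty_iff.2 hns)
      exact hΩV hy (hfW hyf)
    exact hz.1 (hsub hzΩ)
  have hclW : closure Ω ⊆ Wᶜ := closure_minimal hΩW.subset_compl_right hW.isClosed_compl
  have hxΩ : x ∉ Ω := fun h => hΩV h hxV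
  have hmeet : (frontier Ω \ {x}).Nonempty := by
    by_contra hemp
    rw [not_nonempty_iff_eq_empty, sdiff_eq_empty] at hemp
    have hcon : IsPreconnected ({x}ᶜ : Set ℂ) :=
      (isConnected_compl_singleton_of_one_lt_rank (by simp) x).isPreconnected
    obtain ⟨w, hw⟩ := hWne
    have hwx : w ≠ x := fun h => Set.disjoint_left.1 hWV hw (h ▸ hxV)
    obtain ⟨y, hy, hyf⟩ := hcon.inter_frontier_nonempty (t := Ω)
      ⟨z, hz.2, hzΩ⟩ ⟨w, hwx, fun h => Set.disjoint_left.1 hΩW h hw⟩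
    exact hy (hemp hyf)
  have hcl : IsPreconnected (closure Ω \ {x}) :=
    hΩc.subset_closure (fun y hy => ⟨subset_closure hy, fun h => hxΩ (h ▸ hy)⟩) sdiff_subset
  obtain ⟨y, hy⟩ := hmeet
  refine ⟨V \ {x} ∪ closure Ω \ {x}, union_subset (sdiff_subset_sdiff_left hVW)
    (sdiff_subset_sdiff_left hclW), Or.inl hv, Or.inr ⟨subset_closure hzΩ, hz.2⟩, ?_⟩
  exact hVx.union y ⟨hfΩ hy.1, hy.2⟩ ⟨frontier_subset_closure hy.1, hy.2⟩ hcl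

theorem exists_ball_joinedIn {V W : Set ℂ} {x : ℂ} (hV : IsClosed V) (hW : IsOpen W)
    (hWc : IsPreconnected W) (hWV : Disjoint W V) (hfW : frontier W ⊆ V)
    (hM : ∀ ε > 0, ∃ M, IsClosed M ∧ IsPreconnected M ∧ M ⊆ V \ {x} ∧ V \ ball x ε ⊆ M) {ε : ℝ}
    (hε : 0 < ε) :
    ∃ δ > 0, ∀ p ∈ W ∩ ball x δ, ∀ q ∈ W ∩ ball x δ, JoinedIn (W ∩ ball x ε) p q := by
  obtain ⟨M, hMc, hMp, hMV, hVM⟩ := hM ε hε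
  have hxM : x ∈ Mᶜ := fun h => (hMV h).2 rfl
  obtain ⟨δ₀, hδ₀, hδM⟩ := Metric.isOpen_iff.1 hMc.isOpen_compl x hxM
  refine ⟨min δ₀ ε, lt_min hδ₀ hε, fun p hp q hq => ?_⟩
  have hpW : ∀ p ∈ W ∩ ball x (min δ₀ ε), p ∉ V ∪ sphere x ε := by
    rintro p hp (h | h)
    · exact Set.disjoint_left.1 hWV hp.1 h
    · have := hp.2
      rw [mem_ball, lt_min_iff] at this
      exact this.2.ne h
  have l₁ : HasLog (fun z => (z - p) / (z - q)) V :=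
    ((hW.isConnected_iff_isPathConnected.1 ⟨⟨p, hp.1⟩, hWc⟩).joinedIn p hp.1 q hq.1).hasLog_div hWV
  have l₂ : HasLog (fun z => (z - p) / (z - q)) (M ∪ sphere x ε) := by
    refine ((convex_ball x (min δ₀ ε)).isPathConnected ⟨p, hp.2⟩ |>.joinedIn p hp.2 q
      hq.2).hasLog_div ?_
    rw [Set.disjoint_left]
    rintro z hz (hzM | hzs)
    · exact hδM (ball_subset_ball (min_le_left _ _) hz) hzM
    · exact (lt_of_lt_of_le (mem_ball.1 hz) (min_le_right _ _)).ne hzs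
  have hMs : IsClosed (M ∪ sphere x ε) := hMc.union isClosed_sphere
  have hinter : V ∩ (M ∪ sphere x ε) = M := by
    refine subset_antisymm ?_ fun z hz => ⟨(hMV hz).1, Or.inl hz⟩
    rintro z ⟨hzV, hzM | hzs⟩
    · exact hzM
    · exact hVM ⟨hzV, fun hb => (mem_ball.1 hb).ne hzs⟩
  have l : HasLog (fun z => (z - p) / (z - q)) (V ∪ sphere x ε) :=
    (l₁.union_of_closure_inter_subset l₂ (by rwa [hinter])
      (by rw [hV.closure_eq]; exact inter_subset_left)
      (by rw [hMs.closure_eq]; exact inter_subset_left)).mono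
      (union_subset_union_right _ subset_union_right)
  have hcl : IsClosed (V ∪ sphere x ε) := hV.union isClosed_sphere
  set Ω := connectedComponentIn (V ∪ sphere x ε)ᶜ p with hΩ
  have hpΩ : p ∈ Ω := mem_connectedComponentIn (hpW p hp)
  have hΩsub : Ω ⊆ (V ∪ sphere x ε)ᶜ := connectedComponentIn_subset _ _
  have hΩc : IsPreconnected Ω := isPreconnected_connectedComponentIn
  have hΩball : Ω ⊆ ball x ε := by
    by_contra hns
    obtain ⟨y, hy, hyf⟩ := hΩc.inter_frontier_nonempty
      ⟨p, hpΩ, ball_subset_ball (min_le_right _ _) hp.2⟩ (inter_compl_nonempty_iff.2 hns)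
    rw [frontier_ball _ hε.ne'] at hyf
    exact hΩsub hy (Or.inr hyf)
  have hΩW : Ω ⊆ W := by
    by_contra hns
    obtain ⟨y, hy, hyf⟩ := hΩc.inter_frontier_nonempty ⟨p, hpΩ, hp.1⟩
      (inter_compl_nonempty_iff.2 hns)
    exact hΩsub hy (Or.inl (hfW hyf))
  have hqΩ : q ∈ Ω := mem_connectedComponentIn_of_hasLog hcl (hpW p hp) (hpW q hq)
    (isBounded_ball.subset hΩball) l
  have hΩo : IsOpen Ω := hcl.isOpen_compl.connectedComponentIn
  exact ((hΩo.isConnected_iff_isPathConnected.1 ⟨⟨p, hpΩ⟩, hΩc⟩).joinedIn p hpΩ q hqΩ).mono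
    (subset_inter hΩW hΩball)

theorem joinedIn_insert_of_tendsto {X : Type*} [TopologicalSpace X] {S : Set X} {x : X} {p : ℕ → X}
    (γ : ∀ n, Path (p n) (p (n + 1))) (hS : ∀ n t, γ n t ∈ S)
    (hlim : ∀ N ∈ nhds x, ∃ n₀, ∀ n ≥ n₀, ∀ t, γ n t ∈ N) : JoinedIn (insert x S) (p 0) x := by
  classical
  let f : ℝ → X := fun t => (γ ⌊t⌋₊).extend (t - ⌊t⌋₊)
  have hfe : ∀ t, ∃ s, f t = γ ⌊t⌋₊ s := fun t => by
    have : f t ∈ range (γ ⌊t⌋₊).extend := ⟨_, rfl⟩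
    rw [Path.extend_range] at this
    exact this.imp fun _ => Eq.symm
  have hff : ∀ (n : ℕ) t, ⌊t⌋₊ = n → f t = (γ n).extend (t - n) := by
    rintro n t rfl
    rfl
  have hfn : ∀ n : ℕ, EqOn f (fun t => (γ n).extend (t - n)) (Icc (n : ℝ) (n + 1)) := by
    intro n t ht
    rcases eq_or_lt_of_le ht.2 with h | h
    · have : ⌊t⌋₊ = n + 1 := by rw [h]; exact_mod_cast Nat.floor_natCast (n + 1)
      rw [hff (n + 1) t this, h]
      simp
    · exact hff n t ((Nat.floor_eq_iff ((Nat.cast_nonneg n).trans ht.1)).2 ⟨ht.1, h⟩)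
  have hloc : LocallyFinite fun n : ℕ => Icc (n : ℝ) (n + 1) := by
    intro y
    refine ⟨ball y 1, ball_mem_nhds _ one_pos, (finite_Iic ⌈y + 1⌉₊).subset ?_⟩
    rintro n ⟨z, hz, hzb⟩
    rw [Real.ball_eq_Ioo] at hzb
    have : (n : ℝ) ≤ ⌈y + 1⌉₊ := (hz.1.trans hzb.2.le).trans (Nat.le_ceil _)
    exact_mod_cast this
  have hcov : Ici (0 : ℝ) ⊆ ⋃ n : ℕ, Icc (n : ℝ) (n + 1) := fun t ht =>
    mem_iUnion.2 ⟨⌊t⌋₊, Nat.floor_le ht, (Nat.lt_floor_add_one t).le⟩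
  have hf : ContinuousOn f (Ici 0) := by
    refine (hloc.continuousOn_iUnion (fun _ => isClosed_Icc) fun n => ?_).mono hcov
    exact ((γ n).continuous_extend.comp (continuous_id.sub continuous_const)).continuousOn.congr
      (hfn n)
  let g : ℝ → X := fun s => if s < 1 then f (s / (1 - s)) else x
  refine JoinedIn.ofLine (f := g) ?_ ?_ ?_ ?_
  · intro s hs
    rcases eq_or_lt_of_le hs.2 with h | h
    · subst h
      have hg1 : g 1 = x := by simp [g]
      rw [ContinuousWithinAt, hg1]
      intro N hN
      obtain ⟨n₀, hn₀⟩ := hlim N hN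
      have hpos : (0 : ℝ) < n₀ + 1 := by positivity
      have hev : ∀ᶠ s : ℝ in nhdsWithin 1 (Icc 0 1), 1 - (n₀ + 1 : ℝ)⁻¹ < s :=
        mem_nhdsWithin_of_mem_nhds (Ioi_mem_nhds (by simpa using hpos))
      rw [Filter.mem_map]
      filter_upwards [hev] with s hs
      rw [mem_preimage]
      by_cases h1 : s < 1
      · obtain ⟨r, hr⟩ := hfe (s / (1 - s))
        simp only [g, h1, if_true, hr]
        refine hn₀ _ (Nat.le_floor ?_) _
        have h2 : 0 < 1 - s := by linarith
        rw [le_div_iff₀ h2]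
        have h3 : (1 - s) * (n₀ + 1) < 1 := by
          have := mul_lt_mul_of_pos_right (show 1 - s < (n₀ + 1 : ℝ)⁻¹ by linarith) hpos
          rwa [inv_mul_cancel₀ hpos.ne'] at this
        nlinarith
      · simp only [g, h1, if_false]
        exact mem_of_mem_nhds hN
    · have hcts : ContinuousOn (fun s : ℝ => f (s / (1 - s))) (Icc 0 1 ∩ Iio 1) := by
        refine hf.comp (continuousOn_id.div (continuousOn_const.sub continuousOn_id) ?_) ?_
        · intro s hs
          exact (sub_pos.2 hs.2).ne'
        · intro s hs
          exact div_nonneg hs.1.1 (sub_pos.2 hs.2).le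
      have := (hcts s ⟨hs, h⟩).congr (g := g) (fun y hy => if_pos hy.2) (if_pos h)
      exact this.mono_of_mem_nhdsWithin
        (Filter.inter_mem self_mem_nhdsWithin (mem_nhdsWithin_of_mem_nhds (Iio_mem_nhds h)))
  · simp [g, f]
  · simp [g]
  · rintro _ ⟨s, -, rfl⟩
    by_cases h1 : s < 1
    · obtain ⟨r, hr⟩ := hfe (s / (1 - s))
      simp only [g, h1, if_true, hr]
      exact Or.inr (hS _ _)
    · simp [g, h1]

theorem joinedIn_insert_of_locallyJoined {W : Set ℂ} {x w : ℂ} (hx : x ∈ closure W)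
    (hW : IsPathConnected W)
    (hloc : ∀ ε > 0, ∃ δ > 0, ∀ p ∈ W ∩ ball x δ, ∀ q ∈ W ∩ ball x δ, JoinedIn (W ∩ ball x ε) p q)
    (hw : w ∈ W) : JoinedIn (insert x W) w x := by
  have hpos : ∀ n : ℕ, (0 : ℝ) < 1 / (n + 1) := fun n => by positivity
  choose δ hδ hδj using fun n : ℕ => hloc (1 / (n + 1)) (hpos n)
  let η : ℕ → ℝ := fun n => Nat.rec (δ 0) (fun k r => min r (δ (k + 1))) n
  have hη0 : ∀ n, 0 < η n := by
    intro n
    induction n with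
    | zero => exact hδ 0
    | succ k ih => exact lt_min ih (hδ _)
  have hηδ : ∀ n, η n ≤ δ n := by
    intro n
    cases n with
    | zero => exact le_rfl
    | succ k => exact min_le_right _ _
  have hηs : ∀ n, η (n + 1) ≤ η n := fun n => min_le_left _ _
  have hex : ∀ n, ∃ p ∈ W, p ∈ ball x (η n) := fun n => by
    obtain ⟨p, hp, hpd⟩ := Metric.mem_closure_iff.1 hx (η n) (hη0 n)
    exact ⟨p, hp, mem_ball'.2 hpd⟩
  choose p hpW hpb using hex
  have hj : ∀ n : ℕ, JoinedIn (W ∩ ball x (1 / (n + 1))) (p n) (p (n + 1)) := fun n =>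
    hδj n _ ⟨hpW n, ball_subset_ball (hηδ n) (hpb n)⟩ _
      ⟨hpW _, ball_subset_ball ((hηs n).trans (hηδ n)) (hpb (n + 1))⟩
  have key : JoinedIn (insert x W) (p 0) x := by
    refine joinedIn_insert_of_tendsto (fun n => (hj n).somePath)
      (fun n t => ((hj n).somePath_mem t).1) fun N hN => ?_
    obtain ⟨ε, hε, hN⟩ := Metric.mem_nhds_iff.1 hN
    obtain ⟨n₀, hn₀⟩ := exists_nat_one_div_lt hε
    refine ⟨n₀, fun n hn t => hN (ball_subset_ball ?_ ((hj n).somePath_mem t).2)⟩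
    exact (Nat.one_div_le_one_div hn).trans hn₀.le
  exact ((hW.joinedIn w hw _ (hpW 0)).mono (subset_insert _ _)).trans key

theorem joinedIn_union_pair_of_locallyJoined {W : Set ℂ} {x y : ℂ} (hx : x ∈ closure W)
    (hy : y ∈ closure W) (hW : IsPathConnected W)
    (hlocx : ∀ ε > 0, ∃ δ > 0, ∀ p ∈ W ∩ ball x δ, ∀ q ∈ W ∩ ball x δ,
      JoinedIn (W ∩ ball x ε) p q)
    (hlocy : ∀ ε > 0, ∃ δ > 0, ∀ p ∈ W ∩ ball y δ, ∀ q ∈ W ∩ ball y δ,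
      JoinedIn (W ∩ ball y ε) p q) : JoinedIn (W ∪ {x, y}) x y := by
  obtain ⟨w, hw⟩ := hW.nonempty
  refine ((joinedIn_insert_of_locallyJoined hx hW hlocx hw).symm.mono ?_).trans
    ((joinedIn_insert_of_locallyJoined hy hW hlocy hw).mono ?_)
  · rintro z (rfl | hz)
    · exact Or.inr (Or.inl rfl)
    · exact Or.inl hz
  · rintro z (rfl | hz)
    · exact Or.inr (Or.inr rfl)
    · exact Or.inl hz

theorem exists_isCompact_closedBall_diff_ofReal {ρ : ℝ} (h0 : 0 ≤ ρ) (h1 : ρ ≤ 1) {r : ℝ}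
    (hr : 0 < r) : ∃ N ⊆ closedBall (0 : ℂ) 1, IsCompact N ∧ IsPreconnected N ∧ (ρ : ℂ) ∉ N ∧
      closedBall 0 1 \ ball (ρ : ℂ) r ⊆ N ∧ (N ∩ ball 0 1).Nonempty := by
  obtain ⟨η, hη, hηr, hη1⟩ : ∃ η : ℝ, 0 < η ∧ 2 * η ≤ r ∧ η ≤ 1 / 8 :=
    ⟨min (r / 2) (1 / 8), by positivity, by linarith [min_le_left (r / 2) (1 / 8)],
      min_le_right _ _⟩
  obtain ⟨k, hk⟩ : ∃ k : ℝ, k * k = 3 := ⟨√3, Real.mul_self_sqrt (by norm_num)⟩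
  let H : ℝ → ℝ → Set ℂ := fun b c => {z | 2 * η ≤ b * (z.re - ρ) + c * z.im}
  have hHc : ∀ b c, IsClosed (H b c) := fun b c =>
    isClosed_le continuous_const (by fun_prop)
  have hHv : ∀ b c, Convex ℝ (H b c) := by
    intro b c z hz w hw s t hs ht hst
    simp only [H, Set.mem_ofPred_eq, Complex.add_re, Complex.add_im, Complex.real_smul,
      Complex.mul_re, Complex.mul_im, Complex.ofReal_re, Complex.ofReal_im] at *
    obtain rfl : t = 1 - s := by linarith
    nlinarith [mul_le_mul_of_nonneg_left hz hs, mul_le_mul_of_nonneg_left hw ht]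
  have hp : ∀ b c, IsPreconnected (closedBall (0 : ℂ) 1 ∩ H b c) := fun b c =>
    ((convex_closedBall _ _).inter (hHv b c)).isPreconnected
  have hnorm : ∀ c : ℝ, c * c = 3 → (⟨ρ - η, c * η⟩ : ℂ) ∈ ball (0 : ℂ) 1 := by
    intro c hc
    rw [mem_ball_zero_iff, ← sq_lt_one_iff₀ (norm_nonneg _), Complex.sq_norm, Complex.normSq_mk]
    have e : (ρ - η) * (ρ - η) + c * η * (c * η) = ρ * ρ - 2 * ρ * η + 4 * (η * η) := by
      linear_combination (η * η) * hc
    rw [e]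
    nlinarith [mul_nonneg h0 (sub_nonneg.2 h1), mul_nonneg (sub_nonneg.2 h1) hη.le]
  have hm₁ : ∀ c : ℝ, (⟨ρ - η, c * η⟩ : ℂ) ∈ H (-2) 0 := fun c => by
    simp only [H, Set.mem_ofPred_eq]
    linarith
  have hm₂ : ∀ c : ℝ, c * c = 3 → (⟨ρ - η, c * η⟩ : ℂ) ∈ H 1 c := fun c hc => by
    simp only [H, Set.mem_ofPred_eq]
    nlinarith
  have hk' : -k * -k = 3 := by linarith
  refine ⟨closedBall 0 1 ∩ H (-2) 0 ∪ closedBall 0 1 ∩ H 1 k ∪ closedBall 0 1 ∩ H 1 (-k),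
    ?_, ?_, ?_, ?_, ?_, ?_⟩
  · exact union_subset (union_subset inter_subset_left inter_subset_left) inter_subset_left
  · exact (((isCompact_closedBall _ _).inter_right (hHc _ _)).union
      ((isCompact_closedBall _ _).inter_right (hHc _ _))).union
      ((isCompact_closedBall _ _).inter_right (hHc _ _))
  · have h₁₂ : IsPreconnected (closedBall 0 1 ∩ H (-2) 0 ∪ closedBall 0 1 ∩ H 1 k) :=
      (hp (-2) 0).union _ ⟨ball_subset_closedBall (hnorm k hk), hm₁ k⟩
        ⟨ball_subset_closedBall (hnorm k hk), hm₂ k hk⟩ (hp 1 k)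
    exact h₁₂.union _ (Or.inl ⟨ball_subset_closedBall (hnorm _ hk'), hm₁ (-k)⟩)
      ⟨ball_subset_closedBall (hnorm _ hk'), hm₂ _ hk'⟩ (hp 1 (-k))
  · have : ∀ b c, (ρ : ℂ) ∉ H b c := fun b c h => by
      simp only [H, Set.mem_ofPred_eq, Complex.ofReal_re, Complex.ofReal_im] at h
      linarith
    rintro ((h | h) | h) <;> exact this _ _ h.2
  · rintro z ⟨hz, hzb⟩
    by_contra hN
    simp only [mem_union, mem_inter_iff, hz, true_and, not_or, H, Set.mem_ofPred_eq, not_le] at hN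
    obtain ⟨⟨e1, e2⟩, e3⟩ := hN
    apply hzb
    rw [mem_ball, dist_eq_norm, ← sq_lt_sq₀ (norm_nonneg _) hr.le, Complex.sq_norm,
      Complex.normSq_apply]
    simp only [Complex.sub_re, Complex.sub_im, Complex.ofReal_re, Complex.ofReal_im, sub_zero]
    set s := z.re - ρ
    set t := z.im
    have i1 : 0 < (2 * η - s - k * t) * (2 * η - s + k * t) :=
      mul_pos (by linarith) (by linarith)
    have i2 : 0 < (2 * η - s) * (s + η) := mul_pos (by linarith) (by linarith)
    have i3 : 3 * (t * t) < (2 * η - s) * (2 * η - s) := by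
      have : (2 * η - s - k * t) * (2 * η - s + k * t)
        = (2 * η - s) * (2 * η - s) - 3 * (t * t) := by linear_combination -(t * t) * hk
      linarith
    nlinarith
  · exact ⟨_, Or.inl (Or.inl ⟨ball_subset_closedBall (hnorm k hk), hm₁ k⟩), hnorm k hk⟩

theorem exists_isCompact_closedBall_diff {a : ℂ} (ha : a ∈ closedBall (0 : ℂ) 1) {r : ℝ}
    (hr : 0 < r) : ∃ N ⊆ closedBall (0 : ℂ) 1, IsCompact N ∧ IsPreconnected N ∧ a ∉ N ∧
      closedBall 0 1 \ ball a r ⊆ N ∧ (N ∩ ball 0 1).Nonempty := by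
  obtain ⟨N, hN, hNc, hNp, haN, hsub, ⟨w, hwN, hwb⟩⟩ := exists_isCompact_closedBall_diff_ofReal
    (norm_nonneg a) (mem_closedBall_zero_iff.1 ha) hr
  obtain ⟨ω, hω, hωa⟩ : ∃ ω : ℂ, ‖ω‖ = 1 ∧ ω * ‖a‖ = a :=
    ⟨Complex.exp (Complex.arg a * Complex.I), Complex.norm_exp_ofReal_mul_I _, by
      rw [mul_comm, Complex.norm_mul_exp_arg_mul_I]⟩
  have hω0 : ω ≠ 0 := norm_ne_zero_iff.1 (by rw [hω]; exact one_ne_zero)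
  have hcont : Continuous fun z : ℂ => ω * z := by fun_prop
  refine ⟨(fun z => ω * z) '' N, ?_, hNc.image hcont, hNp.image _ hcont.continuousOn, ?_, ?_, ?_⟩
  · rintro _ ⟨z, hz, rfl⟩
    simpa [hω] using hN hz
  · rintro ⟨z, hz, hza⟩
    rw [← hωa] at hza
    exact haN (mul_left_cancel₀ hω0 hza ▸ hz)
  · rintro z ⟨hz, hzb⟩
    have e : z = ω * (ω⁻¹ * z) := by field_simp
    refine ⟨ω⁻¹ * z, hsub ⟨?_, fun hb => hzb ?_⟩, e.symm⟩
    · simpa [hω] using hz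
    · rw [mem_ball, dist_eq_norm] at hb ⊢
      have : z - a = ω * (ω⁻¹ * z - ‖a‖) := by rw [mul_sub, ← e, hωa]
      rwa [this, norm_mul, hω, one_mul]
  · exact ⟨ω * w, ⟨w, hwN, rfl⟩, by simpa [hω] using hwb⟩

theorem exists_isClosed_iUnion_image_diff {ι : Type*} [Finite ι] {φ : ι → ℂ → ℂ}
    (hc : ∀ i, ContinuousOn (φ i) (closedBall 0 1)) (hi : ∀ i, InjOn (φ i) (closedBall 0 1))
    (hU : IsConnected (⋃ i, interior (φ i '' closedBall 0 1))) (x : ℂ) {ε : ℝ} (hε : 0 < ε) :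
    ∃ M, IsClosed M ∧ IsPreconnected M ∧ M ⊆ (⋃ i, φ i '' closedBall 0 1) \ {x} ∧
      (⋃ i, φ i '' closedBall 0 1) \ ball x ε ⊆ M := by
  set U := ⋃ i, interior (φ i '' closedBall 0 1) with hUdef
  have hUo : IsOpen U := isOpen_iUnion fun _ => isOpen_interior
  have hUV : U ⊆ ⋃ i, φ i '' closedBall 0 1 := iUnion_mono fun i => interior_subset
  have hbU : ∀ i, φ i '' ball 0 1 ⊆ U := fun i =>
    (interior_maximal (image_mono ball_subset_closedBall)
      (isOpen_image_ball (hc i) (hi i))).trans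
      (subset_iUnion (fun i => interior (φ i '' closedBall 0 1)) i)
  have hpiece : ∀ i, ∃ N, IsClosed N ∧ IsPreconnected N ∧ N ⊆ φ i '' closedBall 0 1 \ {x} ∧
      φ i '' closedBall 0 1 \ ball x ε ⊆ N ∧ (N ∩ (U \ {x})).Nonempty := by
    intro i
    by_cases hx : x ∈ φ i '' closedBall 0 1
    · obtain ⟨a, ha, rfl⟩ := hx
      obtain ⟨r, hr, hrb⟩ := Metric.continuousOn_iff.1 (hc i) a ha ε hε
      obtain ⟨N, hN, hNc, hNp, haN, hsub, ⟨w, hwN, hwb⟩⟩ := exists_isCompact_closedBall_diff ha hr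
      have hxN : φ i a ∉ φ i '' N := by
        rintro ⟨b, hb, hba⟩
        exact haN (hi i (hN hb) ha hba ▸ hb)
      refine ⟨φ i '' N, (hNc.image_of_continuousOn ((hc i).mono hN)).isClosed,
        hNp.image _ ((hc i).mono hN), ?_, ?_, ?_⟩
      · exact subset_sdiff_singleton (image_mono hN) hxN
      · rintro _ ⟨⟨b, hb, rfl⟩, hbb⟩
        exact ⟨b, hsub ⟨hb, fun h => hbb (hrb b hb h)⟩, rfl⟩
      · exact ⟨φ i w, ⟨w, hwN, rfl⟩, hbU i ⟨w, hwb, rfl⟩, fun h => hxN ⟨w, hwN, h⟩⟩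
    · refine ⟨φ i '' closedBall 0 1, ((isCompact_closedBall _ _).image_of_continuousOn
        (hc i)).isClosed, (convex_closedBall _ _).isPreconnected.image _ (hc i),
        subset_sdiff_singleton Subset.rfl hx, sdiff_subset, φ i 0, ⟨0, by simp, rfl⟩,
        hbU i ⟨0, by simp, rfl⟩, fun h => hx ⟨0, by simp, h⟩⟩
  choose N hNc hNp hNV hVN m hmN hmU using hpiece
  obtain ⟨i₀⟩ : Nonempty ι := by
    obtain ⟨u, hu⟩ := hU.nonempty
    exact ⟨(mem_iUnion.1 hu).choose⟩
  have hUx : IsPathConnected (U \ {x}) :=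
    (hUo.sdiff isClosed_singleton).isConnected_iff_isPathConnected.1
      ⟨⟨m i₀, hmU i₀⟩, hUo.isPreconnected_diff_singleton hU.isPreconnected x⟩
  have hj : ∀ i, JoinedIn (U \ {x}) (m i₀) (m i) := fun i => hUx.joinedIn _ (hmU i₀) _ (hmU i)
  have hUVx : U \ {x} ⊆ (⋃ i, φ i '' closedBall 0 1) \ {x} := sdiff_subset_sdiff_left hUV
  refine ⟨⋃ i, (N i ∪ range (hj i).somePath), ?_, ?_, ?_, ?_⟩
  · exact isClosed_iUnion_of_finite fun i => (hNc i).union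
      (isCompact_range (hj i).somePath.continuous).isClosed
  · refine isPreconnected_iUnion ⟨m i₀, mem_iInter.2 fun i => Or.inr ⟨0, by simp⟩⟩ fun i => ?_
    exact (hNp i).union (m i) (hmN i) ⟨1, by simp⟩ (isPreconnected_range (hj i).somePath.continuous)
  · refine iUnion_subset fun i => union_subset ?_ ?_
    · exact (hNV i).trans (sdiff_subset_sdiff_left
        (subset_iUnion (fun i => φ i '' closedBall (0 : ℂ) 1) i))
    · rintro _ ⟨t, rfl⟩
      exact hUVx ((hj i).somePath_mem t)
  · rintro z ⟨hz, hzb⟩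
    obtain ⟨i, hz⟩ := mem_iUnion.1 hz
    exact mem_iUnion.2 ⟨i, Or.inl (hVN i ⟨hz, hzb⟩)⟩

theorem isPreconnected_diff_singleton_of_forall_ball {V : Set ℂ} {x : ℂ}
    (hM : ∀ ε > 0, ∃ M, IsClosed M ∧ IsPreconnected M ∧ M ⊆ V \ {x} ∧ V \ ball x ε ⊆ M) :
    IsPreconnected (V \ {x}) := by
  refine isPreconnected_of_forall_pair fun p hp q hq => ?_
  have hp0 : 0 < dist p x := dist_pos.2 hp.2
  have hq0 : 0 < dist q x := dist_pos.2 hq.2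
  obtain ⟨M, -, hMp, hMV, hVM⟩ := hM (min (dist p x) (dist q x)) (lt_min hp0 hq0)
  refine ⟨M, hMV, hVM ⟨hp.1, fun h => ?_⟩, hVM ⟨hq.1, fun h => ?_⟩, hMp⟩
  · exact (lt_of_lt_of_le (mem_ball.1 h) (min_le_left _ _)).false
  · exact (lt_of_lt_of_le (mem_ball.1 h) (min_le_right _ _)).false

/-- `W` is the unbounded component of the complement of a family of embedded closed discs whose
interiors have connected union. -/
structure IsDiscUnionComplement {ι : Type*} (φ : ι → ℂ → ℂ) (W : Set ℂ) : Prop where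
  continuousOn : ∀ i, ContinuousOn (φ i) (closedBall 0 1)
  injOn : ∀ i, InjOn (φ i) (closedBall 0 1)
  isConnected : IsConnected (⋃ i, interior (φ i '' closedBall 0 1))
  isOpen : IsOpen W
  isPreconnected : IsPreconnected W
  disjoint : Disjoint W (⋃ i, φ i '' closedBall 0 1)
  frontier_subset : frontier W ⊆ ⋃ i, φ i '' closedBall 0 1
  exists_norm_le : ∃ R, ∀ z, R ≤ ‖z‖ → z ∈ W

namespace IsDiscUnionComplement

variable {ι : Type*} {φ : ι → ℂ → ℂ} {W : Set ℂ}

theorem isCompact_iUnion [Finite ι] (h : IsDiscUnionComplement φ W) :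
    IsCompact (⋃ i, φ i '' closedBall 0 1) :=
  _root_.isCompact_iUnion fun i =>
    (isCompact_closedBall _ _).image_of_continuousOn (h.continuousOn i)

theorem isCompact_frontier [Finite ι] (h : IsDiscUnionComplement φ W) : IsCompact (frontier W) :=
  h.isCompact_iUnion.of_isClosed_subset isClosed_frontier h.frontier_subset

theorem nonempty (h : IsDiscUnionComplement φ W) : W.Nonempty := by
  obtain ⟨R, hR⟩ := h.exists_norm_le
  exact ⟨(|R| : ℝ), hR _ (by simpa using le_abs_self R)⟩

theorem iUnion_diff_singleton_nonempty (h : IsDiscUnionComplement φ W) (x : ℂ) :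
    ((⋃ i, φ i '' closedBall 0 1) \ {x}).Nonempty := by
  obtain ⟨u, hu⟩ := h.isConnected.nonempty
  obtain ⟨i, -⟩ := mem_iUnion.1 hu
  have h0 : (0 : ℂ) ∈ closedBall (0 : ℂ) 1 := by simp
  have h1 : (1 : ℂ) ∈ closedBall (0 : ℂ) 1 := by simp
  by_cases hx : φ i 0 = x
  · refine ⟨φ i 1, mem_iUnion.2 ⟨i, 1, h1, rfl⟩, fun he => ?_⟩
    exact zero_ne_one (h.injOn i h0 h1 (hx.trans (mem_singleton_iff.1 he).symm))
  · exact ⟨φ i 0, mem_iUnion.2 ⟨i, 0, h0, rfl⟩, hx⟩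

theorem frontier_diff_singleton_nonempty (h : IsDiscUnionComplement φ W) (x : ℂ) :
    (frontier W \ {x}).Nonempty := by
  obtain ⟨v, hv, hvx⟩ := h.iUnion_diff_singleton_nonempty x
  obtain ⟨R, hR⟩ := h.exists_norm_le
  have hcon : IsPreconnected ({x}ᶜ : Set ℂ) :=
    (isConnected_compl_singleton_of_one_lt_rank (by simp) x).isPreconnected
  have hn : ‖((|R| + ‖x‖ + 1 : ℝ) : ℂ)‖ = |R| + ‖x‖ + 1 := by
    rw [Complex.norm_real, Real.norm_of_nonneg (by positivity)]
  obtain ⟨y, hy, hyf⟩ := hcon.inter_frontier_nonempty (t := W)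
    ⟨((|R| + ‖x‖ + 1 : ℝ) : ℂ), fun he => by
      rw [mem_singleton_iff] at he
      rw [he] at hn
      linarith [abs_nonneg R], hR _ (by
      rw [hn]
      linarith [le_abs_self R, norm_nonneg x])⟩
    ⟨v, hvx, fun hvW => Set.disjoint_left.1 h.disjoint hvW hv⟩
  exact ⟨y, hyf, hy⟩

theorem isPreconnected_frontier_diff_singleton [Finite ι] (h : IsDiscUnionComplement φ W)
    {x : ℂ} (hx : x ∈ frontier W) : IsPreconnected (frontier W \ {x}) := by
  obtain ⟨R, hR⟩ := h.exists_norm_le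
  have hxW : x ∉ W := fun hxW => Set.disjoint_left.1 h.disjoint hxW (h.frontier_subset hx)
  refine _root_.isPreconnected_frontier_diff_singleton h.isOpen hR ?_ ?_
  · exact h.isPreconnected.subset_closure
      (fun y hy => ⟨subset_closure hy, fun he => hxW (he ▸ hy)⟩) sdiff_subset
  · exact isPreconnected_compl_diff_singleton h.isCompact_iUnion.isClosed
      (isPreconnected_diff_singleton_of_forall_ball fun ε hε =>
        exists_isClosed_iUnion_image_diff h.continuousOn h.injOn h.isConnected x hε)
      (h.iUnion_diff_singleton_nonempty x) (h.frontier_subset hx) h.isOpen h.nonempty h.disjoint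
      h.frontier_subset

theorem joinedIn_interior (h : IsDiscUnionComplement φ W) {x : ℂ} (hx : x ∈ frontier W) :
    ∃ u ∈ ⋃ i, interior (φ i '' closedBall 0 1),
      JoinedIn (insert x (⋃ i, interior (φ i '' closedBall 0 1))) x u := by
  obtain ⟨i, a, ha, rfl⟩ := mem_iUnion.1 (h.frontier_subset hx)
  have hb : φ i '' ball 0 1 ⊆ ⋃ i, interior (φ i '' closedBall 0 1) := fun y hy =>
    mem_iUnion.2 ⟨i, interior_maximal (image_mono ball_subset_closedBall)
      (isOpen_image_ball (h.continuousOn i) (h.injOn i)) hy⟩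
  refine ⟨φ i 0, hb ⟨0, by simp, rfl⟩, ?_⟩
  have ha' : ‖a‖ ≤ 1 := mem_closedBall_zero_iff.1 ha
  have hn : ∀ t ∈ Icc (0 : ℝ) 1, ‖((1 - t : ℝ) : ℂ) * a‖ ≤ 1 - t := fun t ht => by
    have : 0 ≤ 1 - t := sub_nonneg.2 ht.2
    rw [norm_mul, Complex.norm_real, Real.norm_of_nonneg this]
    nlinarith
  refine JoinedIn.ofLine (f := fun t => φ i (((1 - t : ℝ) : ℂ) * a)) ?_ (by simp) (by simp) ?_
  · refine (h.continuousOn i).comp (by fun_prop) fun t ht => ?_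
    exact mem_closedBall_zero_iff.2 ((hn t ht).trans (by linarith [ht.1]))
  · rintro _ ⟨t, ht, rfl⟩
    rcases eq_or_lt_of_le ht.1 with rfl | h0
    · left
      simp
    · exact Or.inr (hb ⟨_, mem_ball_zero_iff.2 ((hn t ht).trans_lt (by linarith)), rfl⟩)

theorem not_isPreconnected_frontier_diff_pair [Finite ι] (h : IsDiscUnionComplement φ W)
    {x y : ℂ} (hx : x ∈ frontier W) (hy : y ∈ frontier W) (hxy : x ≠ y) :
    ¬ IsPreconnected (frontier W \ {x, y}) := by
  have hUo : IsOpen (⋃ i, interior (φ i '' closedBall 0 1)) :=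
    isOpen_iUnion fun _ => isOpen_interior
  have hloc : ∀ x, ∀ ε > 0, ∃ δ > 0, ∀ p ∈ W ∩ ball x δ, ∀ q ∈ W ∩ ball x δ,
      JoinedIn (W ∩ ball x ε) p q := fun x ε hε =>
    exists_ball_joinedIn h.isCompact_iUnion.isClosed h.isOpen h.isPreconnected h.disjoint
      h.frontier_subset (fun ε hε => exists_isClosed_iUnion_image_diff h.continuousOn h.injOn
        h.isConnected x hε) hε
  have hWp : IsPathConnected W :=
    h.isOpen.isConnected_iff_isPathConnected.1 ⟨h.nonempty, h.isPreconnected⟩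
  refine _root_.not_isPreconnected_frontier_diff_pair h.isOpen hxy
    (U := ⋃ i, interior (φ i '' closedBall 0 1)) ?_
    (joinedIn_union_pair_of_locallyJoined (frontier_subset_closure hx)
      (frontier_subset_closure hy) hWp (hloc x) (hloc y)) ?_
  · exact (h.disjoint.symm.mono_left (iUnion_mono fun i => interior_subset)).closure_right hUo
  · obtain ⟨u, hu, hxu⟩ := h.joinedIn_interior hx
    obtain ⟨v, hv, hyv⟩ := h.joinedIn_interior hy
    refine (hxu.mono ?_).trans (((((hUo.isConnected_iff_isPathConnected.1
      h.isConnected).joinedIn u hu v hv)).mono subset_union_left).trans (hyv.symm.mono ?_))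
    · rintro z (rfl | hz)
      · exact Or.inr (Or.inl rfl)
      · exact Or.inl hz
    · rintro z (rfl | hz)
      · exact Or.inr (Or.inr rfl)
      · exact Or.inl hz

end IsDiscUnionComplement

theorem exists_continuous_injective_Icc {Y : Type*} [LinearOrder Y] [TopologicalSpace Y]
    [TopologicalSpace.SeparableSpace Y] [PreconnectedSpace Y] (hlo : ∀ x : Y, IsOpen (Iio x))
    (hhi : ∀ x : Y, IsOpen (Ioi x)) {a b : Y} (hab : a < b) (ha : ∀ x, a ≤ x) (hb : ∀ x, x ≤ b) :
    ∃ h : Y → ℝ, Continuous h ∧ Function.Injective h ∧ range h = Icc 0 1 ∧ h a = 0 ∧ h b = 1 := by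
  have hdense : ∀ x y : Y, x < y → (Ioo x y).Nonempty := by
    intro x y hxy
    obtain ⟨z, -, hz⟩ := isPreconnected_univ (Iio y) (Ioi x) (hlo y) (hhi x)
      (fun z _ => (lt_or_ge z y).imp id fun h => hxy.trans_le h) ⟨x, mem_univ _, hxy⟩
      ⟨y, mem_univ _, hxy⟩
    exact ⟨z, hz.2, hz.1⟩
  obtain ⟨D₀, hD₀c, hD₀⟩ := TopologicalSpace.exists_countable_dense Y
  let D : Set Y := D₀ \ {a, b}
  have hD : ∀ x y : Y, x < y → ∃ d : D, x < d ∧ (d : Y) < y := by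
    intro x y hxy
    obtain ⟨d, hd, hdD⟩ := hD₀.inter_open_nonempty (Ioo x y) ((hhi x).inter (hlo y))
      (hdense x y hxy)
    refine ⟨⟨d, hdD, ?_⟩, hd⟩
    rintro (rfl | rfl)
    · exact (hd.1.trans_le (ha x)).false
    · exact (hd.2.trans_le (hb y)).false
  have had : ∀ d : D, a < d := fun d => (ha d).lt_of_ne fun h => d.2.2 (Or.inl h.symm)
  have hdb : ∀ d : D, (d : Y) < b := fun d => (hb d).lt_of_ne fun h => d.2.2 (Or.inr h)
  have : Countable D := (hD₀c.mono sdiff_subset).to_subtype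
  have : Nonempty D := ⟨(hD a b hab).choose⟩
  have : DenselyOrdered D := ⟨fun x y hxy => hD x y hxy⟩
  have : NoMinOrder D := ⟨fun x => (hD a x (had x)).imp fun _ h => h.2⟩
  have : NoMaxOrder D := ⟨fun x => (hD x b (hdb x)).imp fun _ h => h.1⟩
  have : Nonempty (Ioo (0 : ℚ) 1) := ⟨⟨1 / 2, by norm_num, by norm_num⟩⟩
  obtain ⟨f⟩ := Order.iso_of_countable_dense D (Ioo (0 : ℚ) 1)
  let v : D → ℝ := fun d => ((f d : ℚ) : ℝ)
  have hv : ∀ d e : D, (d : Y) < e → v d < v e := fun d e hde =>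
    Rat.cast_lt.2 (Subtype.coe_lt_coe.2 (f.strictMono hde))
  have hv0 : ∀ d, 0 < v d := fun d => Rat.cast_pos.2 (f d).2.1
  have hv1 : ∀ d, v d < 1 := fun d => by
    exact (Rat.cast_lt.2 (f d).2.2).trans_eq Rat.cast_one
  have hvq : ∀ r s : ℝ, 0 ≤ r → s ≤ 1 → r < s → ∃ d, r < v d ∧ v d < s := by
    intro r s hr hs hrs
    obtain ⟨q, hq⟩ := exists_rat_btwn hrs
    have h0 : 0 < q := by exact_mod_cast hr.trans_lt hq.1
    have h1 : q < 1 := by exact_mod_cast hq.2.trans_le hs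
    exact ⟨f.symm ⟨q, h0, h1⟩, by simpa [v] using hq⟩
  have hex : ∀ x : Y, ∃ r ∈ Icc (0 : ℝ) 1, (∀ d : D, (d : Y) < x → v d ≤ r) ∧
      ∀ d : D, x ≤ d → r ≤ v d := by
    intro x
    let S : Set ℝ := insert 0 (v '' {d | (d : Y) < x})
    have hS1 : ∀ s ∈ S, s ≤ 1 := by
      rintro _ (rfl | ⟨d, -, rfl⟩)
      · exact zero_le_one
      · exact (hv1 d).le
    have hSb : BddAbove S := ⟨1, hS1⟩
    refine ⟨sSup S, ⟨le_csSup hSb (mem_insert _ _), csSup_le ⟨0, mem_insert _ _⟩ hS1⟩, ?_, ?_⟩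
    · exact fun d hd => le_csSup hSb (Or.inr ⟨d, hd, rfl⟩)
    · refine fun d hd => csSup_le ⟨0, mem_insert _ _⟩ ?_
      rintro _ (rfl | ⟨e, he, rfl⟩)
      · exact (hv0 d).le
      · exact (hv e d (lt_of_lt_of_le he hd)).le
  choose h h01 hlow hup using hex
  have hmono : StrictMono h := by
    intro x y hxy
    obtain ⟨d, hxd, hdy⟩ := hD x y hxy
    obtain ⟨e, hde, hey⟩ := hD d y hdy
    exact (hup x d hxd.le).trans_lt ((hv d e hde).trans_le (hlow y e hey))
  have h0 : h a = 0 := by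
    refine le_antisymm (not_lt.1 fun hpos => ?_) (h01 a).1
    obtain ⟨d, -, hd⟩ := hvq 0 (h a) le_rfl (h01 a).2 hpos
    exact (hup a d (ha d)).not_gt hd
  have h1 : h b = 1 := by
    refine le_antisymm (h01 b).2 (not_lt.1 fun hlt => ?_)
    obtain ⟨d, hd, -⟩ := hvq (h b) 1 (h01 b).1 le_rfl hlt
    exact (hlow b d (hdb d)).not_gt hd
  have hcont : Continuous h := by
    refine continuous_iff_continuousAt.2 fun x => tendsto_order.2 ⟨fun r hr => ?_, fun r hr => ?_⟩
    · rcases eq_or_lt_of_le (h01 x).1 with hx | hx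
      · exact Filter.Eventually.of_forall fun y => (hr.trans_eq hx.symm).trans_le (h01 y).1
      · obtain ⟨d, hd, hdx⟩ := hvq (max r 0) (h x) (le_max_right _ _) (h01 x).2 (max_lt hr hx)
        have hdlt : (d : Y) < x := not_le.1 fun hle => (hup x d hle).not_gt hdx
        filter_upwards [(hhi d).mem_nhds hdlt] with y hy
        exact ((le_max_left _ _).trans_lt hd).trans_le (hlow y d hy)
    · rcases eq_or_lt_of_le (h01 x).2 with hx | hx
      · exact Filter.Eventually.of_forall fun y => (h01 y).2.trans_lt (hx.symm.trans_lt hr)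
      · obtain ⟨d, hxd, hd⟩ := hvq (h x) (min r 1) (h01 x).1 (min_le_right _ _) (lt_min hr hx)
        obtain ⟨e, hxe, hed⟩ := hvq (h x) (v d) (h01 x).1 (hv1 d).le hxd
        have hle : x ≤ e := not_lt.1 fun hlt => (hlow x e hlt).not_gt hxe
        have hlt : (e : Y) < d := not_le.1 fun hde => by
          rcases eq_or_lt_of_le hde with he | he
          · exact hed.ne (congrArg v (Subtype.ext he.symm))
          · exact (hv d e he).not_gt hed
        filter_upwards [(hlo d).mem_nhds (hle.trans_lt hlt)] with y hy
        exact (hup y d (le_of_lt hy)).trans_lt (hd.trans_le (min_le_left _ _))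
  refine ⟨h, hcont, hmono.injective, ?_, h0, h1⟩
  refine subset_antisymm (range_subset_iff.2 h01) ?_
  exact (isPreconnected_range hcont).Icc_subset ⟨a, h0⟩ ⟨b, h1⟩

theorem IsPreconnected.diff_of_isOpen {X : Type*} [TopologicalSpace X] {S P Q : Set X} {c : X}
    (hS : IsPreconnected S) (hP : IsOpen P) (hQ : IsOpen Q) (hPQ : S ∩ (P ∩ Q) = ∅) (hcS : c ∈ S)
    (hcQ : c ∉ Q) (hsub : S \ {c} ⊆ P ∪ Q) : IsPreconnected (S \ Q) := by
  classical
  let r : X → X := fun z => if z ∈ Q then c else z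
  have hcov : S \ Q ∪ S \ P = S := by
    ext z
    have : z ∈ S → ¬ (z ∈ P ∧ z ∈ Q) := fun hz h => (hPQ ▸ ⟨hz, h⟩ : z ∈ (∅ : Set X))
    simp only [mem_union, mem_sdiff]
    tauto
  have hr : ContinuousOn r S := by
    have h₁ : ContinuousOn r (S \ Q) := continuousOn_id.congr fun z hz => if_neg hz.2
    have h₂ : ContinuousOn r (S \ P) := (continuousOn_const (c := c)).congr fun z hz => by
      by_cases hzQ : z ∈ Q
      · exact if_pos hzQ
      · have : z = c := by
          by_contra hne
          exact (hsub ⟨hz.1, hne⟩).elim hz.2 hzQ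
        rw [this]
        exact if_neg hcQ
    rw [← hcov]
    refine h₁.union_of_closure_inter_subset h₂ ?_ ?_
    · exact fun z hz => ⟨hz.2.1, closure_minimal (fun _ h => h.2) hQ.isClosed_compl hz.1⟩
    · exact fun z hz => ⟨hz.2.1, closure_minimal (fun _ h => h.2) hP.isClosed_compl hz.1⟩
  convert hS.image r hr using 1
  ext z
  constructor
  · exact fun hz => ⟨z, hz.1, if_neg hz.2⟩
  · rintro ⟨w, hw, rfl⟩
    by_cases hwQ : w ∈ Q
    · simp only [r, hwQ, if_true]
      exact ⟨hcS, hcQ⟩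
    · simp only [r, hwQ, if_false]
      exact ⟨hw, hwQ⟩

theorem exists_continuous_injective_Icc_of_separates {Y : Type*} [TopologicalSpace Y]
    [TopologicalSpace.SeparableSpace Y] [PreconnectedSpace Y] {a b : Y} (hab : a ≠ b)
    (hsep : ∀ x : Y, ∃ L G, IsOpen L ∧ IsOpen G ∧ Disjoint L G ∧ L ∪ G = {x}ᶜ ∧ a ∉ G ∧ b ∉ L) :
    ∃ h : Y → ℝ, Continuous h ∧ Function.Injective h ∧ range h = Icc 0 1 ∧ h a = 0 ∧ h b = 1 := by
  classical
  choose L G hL hG hLG hun haG hbL using hsep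
  have hxL : ∀ x, x ∉ L x := fun x h => (hun x ▸ Or.inl h : x ∈ ({x}ᶜ : Set Y)) rfl
  have hxG : ∀ x, x ∉ G x := fun x h => (hun x ▸ Or.inr h : x ∈ ({x}ᶜ : Set Y)) rfl
  have hcase : ∀ x y, y ≠ x → y ∈ L x ∨ y ∈ G x := fun x y h => by
    have : y ∈ L x ∪ G x := by rwa [hun x]
    exact this
  have hpreL : ∀ x, IsPreconnected (univ \ L x) := fun x =>
    isPreconnected_univ.diff_of_isOpen (hG x) (hL x)
      (by rw [inter_comm (G x), (hLG x).inter_eq, inter_empty]) (mem_univ x) (hxL x)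
      fun y hy => (hcase x y hy.2).symm
  have hpreG : ∀ x, IsPreconnected (univ \ G x) := fun x =>
    isPreconnected_univ.diff_of_isOpen (hL x) (hG x)
      (by rw [(hLG x).inter_eq, inter_empty]) (mem_univ x) (hxG x)
      fun y hy => hcase x y hy.2
  have hsubG : ∀ x y, x ∈ L y → univ \ L y ⊆ G x := by
    intro x y hxy
    refine (hpreL y).subset_right_of_subset_union (hL x) (hG x) (hLG x) ?_
      ⟨b, ⟨mem_univ _, hbL y⟩, ?_⟩
    · exact fun z hz => hcase x z fun h => hz.2 (h ▸ hxy)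
    · exact (hcase x b fun h => hbL y (h ▸ hxy)).resolve_left (hbL x)
  have hsubL : ∀ x y, y ∈ G x → univ \ G x ⊆ L y := by
    intro x y hxy
    refine (hpreG x).subset_left_of_subset_union (hL y) (hG y) (hLG y) ?_
      ⟨a, ⟨mem_univ _, haG x⟩, ?_⟩
    · exact fun z hz => hcase y z fun h => hz.2 (h ▸ hxy)
    · exact (hcase y a fun h => haG x (h ▸ hxy)).resolve_right (haG y)
  have hiff : ∀ x y, x ∈ L y ↔ y ∈ G x := fun x y =>
    ⟨fun h => hsubG x y h ⟨mem_univ _, hxL y⟩, fun h => hsubL x y h ⟨mem_univ _, hxG x⟩⟩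
  have : IsStrictTotalOrder Y fun x y => x ∈ L y :=
    { trichotomous := fun x y h₁ h₂ => by
        by_contra hne
        exact (hcase y x hne).elim h₁ fun h => h₂ ((hiff y x).2 h)
      irrefl := hxL
      trans := fun x y z hxy hyz => hsubL y z ((hiff y z).1 hyz)
        ⟨mem_univ _, fun h => Set.disjoint_left.1 (hLG y) hxy h⟩ }
  let o : LinearOrder Y := linearOrderOfSTO fun x y => x ∈ L y
  have hIio : ∀ x : Y, Iio x = L x := fun x => rfl
  have hIoi : ∀ x : Y, Ioi x = G x := fun x => by
    ext y
    exact hiff x y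
  refine exists_continuous_injective_Icc (fun x => hIio x ▸ hL x) (fun x => hIoi x ▸ hG x) ?_ ?_ ?_
  · exact (hcase b a hab).resolve_right (haG b)
  · exact fun x => not_lt.1 fun h => haG x ((hiff x a).1 h)
  · exact fun x => not_lt.1 fun h => hbL x h

theorem compl_diff_singleton_inter_eq_empty {X : Type*} [TopologicalSpace X] {a b x : X}
    {P Q u v : Set X} (hP : IsOpen P) (hQ : IsOpen Q) (hPQ : Disjoint P Q)
    (hun : P ∪ Q = {a, b}ᶜ) (h₁ : IsPreconnected ({x}ᶜ : Set X)) (hx : x ∈ P) (hu : IsOpen u)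
    (hv : IsOpen v) (hsub : Qᶜ \ {x} ⊆ u ∪ v) (hemp : Qᶜ \ {x} ∩ (u ∩ v) = ∅) (hau : a ∈ u)
    (hbu : b ∈ u) : Qᶜ \ {x} ∩ v = ∅ := by
  have hcase : ∀ z, z ∉ u → z ∉ Q → z ∈ P := fun z hzu hzQ => by
    have : z ∈ P ∪ Q := by
      rw [hun]
      rintro (rfl | rfl)
      exacts [hzu hau, hzu hbu]
    exact this.resolve_right hzQ
  have hax : a ≠ x := by
    rintro rfl
    exact (hun ▸ Or.inl hx : a ∈ ({a, b}ᶜ : Set X)) (Or.inl rfl)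
  rw [← not_nonempty_iff_eq_empty]
  rintro ⟨z, hz, hzv⟩
  have hzu : z ∉ u := fun h => (hemp ▸ ⟨hz, h, hzv⟩ : z ∈ (∅ : Set X))
  obtain ⟨w, hwx, hw₁, hw₂⟩ := h₁ (v ∩ P) (u ∪ Q) (hv.inter hP) (hu.union hQ) (by
      intro w hw
      by_cases hwQ : w ∈ Q
      · exact Or.inr (Or.inr hwQ)
      · by_cases hwu : w ∈ u
        · exact Or.inr (Or.inl hwu)
        · exact Or.inl ⟨(hsub ⟨hwQ, hw⟩).resolve_left hwu, hcase w hwu hwQ⟩)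
    ⟨z, hz.2, hzv, hcase z hzu hz.1⟩ ⟨a, hax, Or.inl hau⟩
  have hwQ : w ∉ Q := Set.disjoint_left.1 hPQ hw₁.2
  have : w ∈ (∅ : Set X) := hemp ▸ ⟨⟨hwQ, hwx⟩, hw₂.resolve_right hwQ, hw₁.1⟩
  exact this

theorem exists_arc_of_not_isPreconnected_compl_pair {X : Type*} [TopologicalSpace X] [T2Space X]
    [SecondCountableTopology X] (h₁ : ∀ x : X, IsPreconnected ({x}ᶜ : Set X))
    (h₂ : ∀ x y : X, x ≠ y → ¬ IsPreconnected ({x, y}ᶜ : Set X)) {a b : X} (hab : a ≠ b)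
    {P Q : Set X} (hP : IsOpen P) (hQ : IsOpen Q) (hPQ : Disjoint P Q) (hPne : P.Nonempty)
    (hQne : Q.Nonempty) (hun : P ∪ Q = {a, b}ᶜ) :
    ∃ h : X → ℝ, ContinuousOn h Qᶜ ∧ InjOn h Qᶜ ∧ h '' Qᶜ = Icc 0 1 ∧ h a = 0 ∧ h b = 1 := by
  classical
  have hcase : ∀ z, z = a ∨ z = b ∨ z ∈ P ∨ z ∈ Q := fun z => by
    by_cases hz : z ∈ ({a, b}ᶜ : Set X)
    · rw [← hun] at hz
      exact Or.inr (Or.inr hz)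
    · rw [notMem_compl_iff] at hz
      exact hz.imp id Or.inl
  have hnot : ∀ z ∈ ({a, b} : Set X), z ∉ P ∧ z ∉ Q := fun z hz =>
    ⟨fun h => (hun ▸ Or.inl h : z ∈ ({a, b}ᶜ : Set X)) hz,
      fun h => (hun ▸ Or.inr h : z ∈ ({a, b}ᶜ : Set X)) hz⟩
  obtain ⟨haP, haQ⟩ := hnot a (Or.inl rfl)
  obtain ⟨hbP, hbQ⟩ := hnot b (Or.inr rfl)
  have hempty : P ∩ Q = ∅ := hPQ.inter_eq
  obtain ⟨p, hp⟩ := hPne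
  obtain ⟨q, hq⟩ := hQne
  have hpQ : p ∉ Q := Set.disjoint_left.1 hPQ hp
  have hconn : IsPreconnected Qᶜ := by
    have ha : IsPreconnected ({b}ᶜ \ Q) := (h₁ b).diff_of_isOpen hP hQ
      (by rw [hempty, inter_empty]) (c := a) hab haQ fun z hz => by
        rcases hcase z with h | h | h
        exacts [(hz.2 h).elim, (hz.1 h).elim, h]
    have hb : IsPreconnected ({a}ᶜ \ Q) := (h₁ a).diff_of_isOpen hP hQ
      (by rw [hempty, inter_empty]) (c := b) hab.symm hbQ fun z hz => by
        rcases hcase z with h | h | h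
        exacts [(hz.1 h).elim, (hz.2 h).elim, h]
    convert IsPreconnected.union (s := {b}ᶜ \ Q) (t := {a}ᶜ \ Q) p
      ⟨fun h => hbP (mem_singleton_iff.1 h ▸ hp), hpQ⟩
      ⟨fun h => haP (mem_singleton_iff.1 h ▸ hp), hpQ⟩ ha hb using 1
    ext z
    have : ¬ (z = a ∧ z = b) := fun h => hab (h.1.symm.trans h.2)
    simp only [mem_compl_iff, mem_union, mem_sdiff, mem_singleton_iff]
    tauto
  have hcut : ∀ x ∈ P, ¬ IsPreconnected (Qᶜ \ {x}) := by
    intro x hx hA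
    have hxq : x ≠ q := fun h => Set.disjoint_left.1 hPQ hx (h ▸ hq)
    refine h₂ x q hxq (isPreconnected_iff_subset_of_disjoint.2 fun u v hu hv hsub hemp => ?_)
    have hAs : Qᶜ \ {x} ⊆ ({x, q}ᶜ : Set X) := by
      rintro z ⟨hzQ, hzx⟩ (rfl | rfl)
      exacts [hzx rfl, hzQ hq]
    have hBs : Pᶜ \ {q} ⊆ ({x, q}ᶜ : Set X) := by
      rintro z ⟨hzP, hzq⟩ (rfl | rfl)
      exacts [hzP hx, hzq rfl]
    have haA : a ∈ Qᶜ \ {x} := ⟨haQ, fun h => haP (mem_singleton_iff.1 h ▸ hx)⟩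
    have hbA : b ∈ Qᶜ \ {x} := ⟨hbQ, fun h => hbP (mem_singleton_iff.1 h ▸ hx)⟩
    have key : ∀ u v : Set X, IsOpen u → IsOpen v → ({x, q}ᶜ : Set X) ⊆ u ∪ v →
        ({x, q}ᶜ : Set X) ∩ (u ∩ v) = ∅ → Qᶜ \ {x} ⊆ u → ({x, q}ᶜ : Set X) ⊆ u := by
      intro u v hu hv hsub hemp hAu z hz
      by_cases hzQ : z ∈ Q
      · have hzP : z ∈ Pᶜ \ {q} :=
          ⟨fun h => Set.disjoint_left.1 hPQ h hzQ, fun h => hz (Or.inr h)⟩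
        have hclean := compl_diff_singleton_inter_eq_empty hQ hP hPQ.symm (by rwa [union_comm])
          (h₁ q) hq hu hv (hBs.trans hsub)
          (subset_empty_iff.1 ((inter_subset_inter_left _ hBs).trans hemp.subset))
          (hAu haA) (hAu hbA)
        exact (hsub hz).resolve_right fun h => (hclean ▸ ⟨hzP, h⟩ : z ∈ (∅ : Set X))
      · exact hAu ⟨hzQ, fun h => hz (Or.inl h)⟩
    rcases isPreconnected_iff_subset_of_disjoint.1 hA u v hu hv (hAs.trans hsub)
      (subset_empty_iff.1 ((inter_subset_inter_left _ hAs).trans hemp.subset)) with h | h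
    · exact Or.inl (key u v hu hv hsub hemp h)
    · exact Or.inr (key v u hv hu (by rwa [union_comm]) (by rwa [inter_comm v]) h)
  have hsep : ∀ x ∈ P, ∃ u v, IsOpen u ∧ IsOpen v ∧ Qᶜ \ {x} ⊆ u ∪ v ∧
      Qᶜ \ {x} ∩ (u ∩ v) = ∅ ∧ a ∉ v ∧ b ∉ u := by
    intro x hx
    have hxa : a ∈ Qᶜ \ {x} := ⟨haQ, fun h => haP (mem_singleton_iff.1 h ▸ hx)⟩
    have hxb : b ∈ Qᶜ \ {x} := ⟨hbQ, fun h => hbP (mem_singleton_iff.1 h ▸ hx)⟩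
    have := hcut x hx
    simp only [IsPreconnected, not_forall] at this
    obtain ⟨u, v, hu, hv, hsub, hune, hvne, hemp⟩ := this
    rw [not_nonempty_iff_eq_empty] at hemp
    have hemp' : Qᶜ \ {x} ∩ (v ∩ u) = ∅ := by rwa [inter_comm v]
    have hx' : ∀ z ∈ Qᶜ \ {x}, ¬ (z ∈ u ∧ z ∈ v) := fun z hz h =>
      (hemp ▸ ⟨hz, h⟩ : z ∈ (∅ : Set X))
    have n₁ : ¬ (a ∈ u ∧ b ∈ u) := fun h =>
      hvne.ne_empty (compl_diff_singleton_inter_eq_empty hP hQ hPQ hun (h₁ x) hx hu hv hsub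
        hemp h.1 h.2)
    have n₂ : ¬ (a ∈ v ∧ b ∈ v) := fun h =>
      hune.ne_empty (compl_diff_singleton_inter_eq_empty hP hQ hPQ hun (h₁ x) hx hv hu
        (by rwa [union_comm]) hemp' h.1 h.2)
    have ca := hsub hxa
    have cb := hsub hxb
    have da := hx' a hxa
    have db := hx' b hxb
    simp only [mem_union] at ca cb
    by_cases hau : a ∈ u
    · exact ⟨u, v, hu, hv, hsub, hemp, by tauto, by tauto⟩
    · exact ⟨v, u, hv, hu, by rwa [union_comm], hemp', by tauto, by tauto⟩
  have : PreconnectedSpace ↥Qᶜ := isPreconnected_iff_preconnectedSpace.1 hconn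
  obtain ⟨g, hgc, hgi, hgr, hg0, hg1⟩ := exists_continuous_injective_Icc_of_separates
    (Y := ↥Qᶜ) (a := ⟨a, haQ⟩) (b := ⟨b, hbQ⟩) (fun h => hab (congrArg Subtype.val h)) (by
      rintro ⟨x, hxQ⟩
      rcases hcase x with rfl | rfl | h | h
      · exact ⟨∅, {⟨x, hxQ⟩}ᶜ, isOpen_empty, isOpen_compl_singleton, empty_disjoint _,
          empty_union _, fun h => h rfl, id⟩
      · exact ⟨{⟨x, hxQ⟩}ᶜ, ∅, isOpen_compl_singleton, isOpen_empty, disjoint_empty _,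
          union_empty _, id, fun h => h rfl⟩
      · obtain ⟨u, v, hu, hv, hsub, hemp, hav, hbu⟩ := hsep x h
        refine ⟨Subtype.val ⁻¹' u \ {⟨x, hxQ⟩}, Subtype.val ⁻¹' v \ {⟨x, hxQ⟩},
          (hu.preimage continuous_subtype_val).sdiff isClosed_singleton,
          (hv.preimage continuous_subtype_val).sdiff isClosed_singleton, ?_, ?_,
          fun h => hav h.1, fun h => hbu h.1⟩
        · rw [Set.disjoint_left]
          rintro ⟨z, hz⟩ ⟨hzu, hzx⟩ ⟨hzv, -⟩
          have : z ∈ (∅ : Set X) := hemp ▸ ⟨⟨hz, fun h => hzx (Subtype.ext h)⟩, hzu, hzv⟩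
          exact this
        · ext ⟨z, hz⟩
          have : z ≠ x → z ∈ u ∨ z ∈ v := fun h => hsub ⟨hz, h⟩
          simp only [mem_union, mem_sdiff, mem_preimage, mem_singleton_iff, mem_compl_iff,
            Subtype.mk.injEq]
          tauto
      · exact (hxQ h).elim)
  let h : X → ℝ := fun z => if hz : z ∈ Qᶜ then g ⟨z, hz⟩ else 0
  have hh : ∀ z (hz : z ∈ Qᶜ), h z = g ⟨z, hz⟩ := fun z hz => dif_pos hz
  refine ⟨h, ?_, ?_, ?_, (hh a haQ).trans hg0, (hh b hbQ).trans hg1⟩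
  · rw [continuousOn_iff_continuous_domRestrict]
    convert hgc using 1
    ext z
    exact hh z z.2
  · intro z hz w hw he
    rw [hh z hz, hh w hw] at he
    exact congrArg Subtype.val (hgi he)
  · rw [← hgr]
    ext r
    constructor
    · rintro ⟨z, hz, rfl⟩
      exact ⟨⟨z, hz⟩, (hh z hz).symm⟩
    · rintro ⟨z, rfl⟩
      exact ⟨z, z.2, hh z z.2⟩

theorem nonempty_homeomorph_circle {X : Type*} [TopologicalSpace X] [CompactSpace X] [T2Space X]
    [SecondCountableTopology X] [Nontrivial X] (h₁ : ∀ x : X, IsPreconnected ({x}ᶜ : Set X))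
    (h₂ : ∀ x y : X, x ≠ y → ¬ IsPreconnected ({x, y}ᶜ : Set X)) : Nonempty (X ≃ₜ Circle) := by
  classical
  obtain ⟨a, b, hab⟩ := exists_pair_ne X
  obtain ⟨P, Q, hP, hQ, hPQ, hPne, hQne, hun⟩ : ∃ P Q : Set X, IsOpen P ∧ IsOpen Q ∧
      Disjoint P Q ∧ P.Nonempty ∧ Q.Nonempty ∧ P ∪ Q = {a, b}ᶜ := by
    have hO : IsOpen ({a, b}ᶜ : Set X) := (toFinite {a, b}).isClosed.isOpen_compl
    have := h₂ a b hab
    simp only [IsPreconnected, not_forall] at this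
    obtain ⟨u, v, hu, hv, hsub, hune, hvne, hemp⟩ := this
    refine ⟨{a, b}ᶜ ∩ u, {a, b}ᶜ ∩ v, hO.inter hu, hO.inter hv, ?_, hune, hvne, ?_⟩
    · rw [Set.disjoint_left]
      exact fun z hz hz' => hemp ⟨z, hz.1, hz.2, hz'.2⟩
    · rw [← inter_union_distrib_left]
      exact inter_eq_left.2 hsub
  obtain ⟨f, hfc, hfi, hfr, hfa, hfb⟩ :=
    exists_arc_of_not_isPreconnected_compl_pair h₁ h₂ hab hP hQ hPQ hPne hQne hun
  obtain ⟨g, hgc, hgi, hgr, hga, hgb⟩ := exists_arc_of_not_isPreconnected_compl_pair h₁ h₂ hab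
    hQ hP hPQ.symm hQne hPne (by rwa [union_comm])
  have hf01 : ∀ z ∉ Q, f z ∈ Icc (0 : ℝ) 1 := fun z hz => hfr ▸ mem_image_of_mem f hz
  have hg01 : ∀ z ∉ P, g z ∈ Icc (0 : ℝ) 1 := fun z hz => hgr ▸ mem_image_of_mem g hz
  have hQP : ∀ z ∈ Q, z ∉ P := fun z hz hzP => Set.disjoint_left.1 hPQ hzP hz
  have hnot : ∀ z ∈ ({a, b} : Set X), z ∉ P ∧ z ∉ Q := fun z hz =>
    ⟨fun h => (hun ▸ Or.inl h : z ∈ ({a, b}ᶜ : Set X)) hz,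
      fun h => (hun ▸ Or.inr h : z ∈ ({a, b}ᶜ : Set X)) hz⟩
  obtain ⟨haP, haQ⟩ := hnot a (Or.inl rfl)
  obtain ⟨hbP, hbQ⟩ := hnot b (Or.inr rfl)
  have hgQ : ∀ z ∈ Q, 0 < g z ∧ g z < 1 := fun z hz =>
    ⟨(hg01 z (hQP z hz)).1.lt_of_ne fun h =>
      haQ (hgi (hQP z hz) haP (h.symm.trans hga.symm) ▸ hz),
      (hg01 z (hQP z hz)).2.lt_of_ne fun h => hbQ (hgi (hQP z hz) hbP (h.trans hgb.symm) ▸ hz)⟩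
  have hpi := Real.pi_pos
  let θ : X → ℝ := fun z => if z ∈ Q then -(Real.pi * g z) else Real.pi * f z
  have hθQ : ∀ z ∈ Q, θ z = -(Real.pi * g z) := fun z hz => if_pos hz
  have hθ : ∀ z ∉ Q, θ z = Real.pi * f z := fun z hz => if_neg hz
  have hneg : ∀ z ∈ Q, θ z < 0 := fun z hz => by
    rw [hθQ z hz]
    exact neg_neg_of_pos (mul_pos hpi (hgQ z hz).1)
  have hpos : ∀ z ∉ Q, 0 ≤ θ z := fun z hz => by
    rw [hθ z hz]
    exact mul_nonneg hpi.le (hf01 z hz).1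
  have hθlo : ∀ z, -Real.pi < θ z := fun z => by
    by_cases hz : z ∈ Q
    · rw [hθQ z hz]
      nlinarith [(hgQ z hz).2]
    · linarith [hpos z hz]
  have hθhi : ∀ z, θ z ≤ Real.pi := fun z => by
    by_cases hz : z ∈ Q
    · linarith [hneg z hz]
    · rw [hθ z hz]
      nlinarith [(hf01 z hz).2]
  have hθi : Function.Injective θ := by
    intro z w he
    by_cases hz : z ∈ Q
    · by_cases hw : w ∈ Q
      · rw [hθQ z hz, hθQ w hw, neg_inj] at he
        exact hgi (hQP z hz) (hQP w hw) (mul_left_cancel₀ hpi.ne' he)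
      · exact absurd he ((hneg z hz).trans_le (hpos w hw)).ne
    · by_cases hw : w ∈ Q
      · exact absurd he ((hneg w hw).trans_le (hpos z hz)).ne'
      · rw [hθ z hz, hθ w hw] at he
        exact hfi hz hw (mul_left_cancel₀ hpi.ne' he)
  have hcov : Qᶜ ∪ Pᶜ = (univ : Set X) := by
    rw [← compl_inter, inter_comm, hPQ.inter_eq, compl_empty]
  have hcont : Continuous fun z => Circle.exp (θ z) := by
    rw [← continuousOn_univ, ← hcov]
    refine ContinuousOn.union_of_isClosed ?_ ?_ hQ.isClosed_compl hP.isClosed_compl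
    · exact (Circle.exp.continuous.comp_continuousOn (continuousOn_const.mul hfc)).congr
        fun z hz => by rw [hθ z hz]; rfl
    · refine (Circle.exp.continuous.comp_continuousOn
        ((continuousOn_const (c := Real.pi)).mul hgc).neg).congr fun z hz => ?_
      by_cases hzQ : z ∈ Q
      · rw [hθQ z hzQ]
        rfl
      · have hz' : z ∈ ({a, b} : Set X) := by
          by_contra h
          exact (hun ▸ h : z ∈ P ∪ Q).elim hz hzQ
        rw [hθ z hzQ]
        rcases hz' with rfl | rfl
        · simp [hfa, hga]
        · have : Circle.exp (-Real.pi) = Circle.exp Real.pi := by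
            rw [Circle.exp_eq_exp]
            exact ⟨-1, by push_cast; ring⟩
          simp [hfb, hgb, this]
  have hbij : Function.Bijective fun z => Circle.exp (θ z) := by
    refine ⟨fun z w he => hθi ?_, fun c => ?_⟩
    · have := congrArg (fun c : Circle => Complex.arg c) he
      simpa only [Circle.arg_exp (hθlo _) (hθhi _)] using this
    · have h₁ := Complex.neg_pi_lt_arg (c : ℂ)
      have h₂ := Complex.arg_le_pi (c : ℂ)
      rcases le_or_gt 0 (Complex.arg c) with h | h
      · have : Complex.arg c / Real.pi ∈ f '' Qᶜ := by
          rw [hfr]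
          exact ⟨div_nonneg h hpi.le, (div_le_one hpi).2 h₂⟩
        obtain ⟨z, hz, hzc⟩ := this
        refine ⟨z, ?_⟩
        simp only [hθ z hz, hzc, mul_div_cancel₀ _ hpi.ne']
        exact Circle.exp_arg c
      · have : -Complex.arg c / Real.pi ∈ g '' Pᶜ := by
          rw [hgr]
          exact ⟨div_nonneg (by linarith) hpi.le, (div_le_one hpi).2 (by linarith)⟩
        obtain ⟨z, hz, hzc⟩ := this
        have hzQ : z ∈ Q := by
          by_contra hzQ
          have hz' : z ∈ ({a, b} : Set X) := by
            by_contra h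
            exact (hun ▸ h : z ∈ P ∪ Q).elim hz hzQ
          rcases hz' with rfl | rfl
          · rw [hga, eq_comm, div_eq_zero_iff] at hzc
            rcases hzc with h | h <;> linarith
          · rw [hgb, eq_comm, div_eq_one_iff_eq hpi.ne'] at hzc
            linarith
        refine ⟨z, ?_⟩
        simp only [hθQ z hzQ, hzc, mul_div_cancel₀ _ hpi.ne', neg_neg]
        exact Circle.exp_arg c
  exact ⟨Continuous.homeoOfEquivCompactToT2 (f := Equiv.ofBijective _ hbij) hcont⟩

theorem IsDiscUnionComplement.nonempty_homeomorph_circle {ι : Type*} [Finite ι] {φ : ι → ℂ → ℂ}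
    {W : Set ℂ} (h : IsDiscUnionComplement φ W) : Nonempty (frontier W ≃ₜ Circle) := by
  have : CompactSpace (frontier W) := isCompact_iff_compactSpace.1 h.isCompact_frontier
  have himage : ∀ S : Set (frontier W), IsPreconnected ((↑) '' S : Set ℂ) ↔ IsPreconnected S :=
    fun S => Topology.IsInducing.subtypeVal.isPreconnected_image
  have : Nontrivial (frontier W) := by
    obtain ⟨x, hx, -⟩ := h.frontier_diff_singleton_nonempty 0
    obtain ⟨y, hy, hyx⟩ := h.frontier_diff_singleton_nonempty x
    exact ⟨⟨y, hy⟩, ⟨x, hx⟩, fun he => hyx (congrArg Subtype.val he)⟩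
  refine _root_.nonempty_homeomorph_circle (fun x => ?_) fun x y hxy => ?_
  · rw [← himage]
    convert h.isPreconnected_frontier_diff_singleton x.2 using 1
    ext z
    simp [and_comm]
  · rw [← himage]
    convert h.not_isPreconnected_frontier_diff_pair x.2 y.2 (fun he => hxy (Subtype.ext he)) using 2
    ext z
    simp only [mem_image, mem_compl_iff, mem_insert_iff, mem_singleton_iff, Subtype.exists,
      Subtype.ext_iff, exists_and_left, exists_prop, exists_eq_right_right, mem_sdiff]
    tauto

theorem nonempty_frontier_homeomorph_circle {X : Type*} [TopologicalSpace X] [CompactSpace X]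
    [T2Space X] {g : ℂ → X} (hg : Topology.IsOpenEmbedding g) {v : X} (hgv : range g = {v}ᶜ)
    {ι : Type*} [Finite ι] {V : ι → Set X}
    (hV : ∀ i, ∃ c : closedBall (0 : ℂ) 1 → X, Continuous c ∧ Function.Injective c ∧
      range c = V i) (hconn : IsConnected (⋃ i, interior (V i))) {W : Set X} (hWo : IsOpen W)
    (hWp : IsPreconnected W) (hvW : v ∈ W) (hWV : Disjoint W (⋃ i, V i))
    (hfW : frontier W ⊆ ⋃ i, V i) : Nonempty (frontier W ≃ₜ Circle) := by
  classical
  have hgc := hg.continuous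
  have hgi := hg.injective
  have hgo := hg.isOpenMap
  have hrange : ∀ S : Set X, v ∉ S → S ⊆ range g := fun S hS x hx => by
    rw [hgv]
    rintro rfl
    exact hS hx
  have hvV : v ∉ ⋃ i, V i := Set.disjoint_left.1 hWV hvW
  have hφ : ∀ i, ∃ φ : ℂ → ℂ, ContinuousOn φ (closedBall 0 1) ∧ InjOn φ (closedBall 0 1) ∧
      φ '' closedBall 0 1 = g ⁻¹' V i := by
    intro i
    obtain ⟨c, hc, hci, hcr⟩ := hV i
    have hcg : ∀ z, ∃ w, g w = c z := fun z =>
      hrange (⋃ i, V i) hvV (mem_iUnion.2 ⟨i, hcr ▸ mem_range_self z⟩)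
    choose k hk using hcg
    have hkc : Continuous k := by
      rw [hg.isInducing.continuous_iff]
      exact hc.congr fun z => (hk z).symm
    have hki : Function.Injective k := fun z w he => hci (by rw [← hk, ← hk, he])
    refine ⟨fun z => if hz : z ∈ closedBall (0 : ℂ) 1 then k ⟨z, hz⟩ else 0, ?_, ?_, ?_⟩
    · rw [continuousOn_iff_continuous_domRestrict]
      convert hkc using 1
      ext z
      exact dif_pos z.2
    · intro z hz w hw he
      simp only [hz, hw, dif_pos] at he
      exact congrArg Subtype.val (hki he)
    · ext w
      rw [mem_preimage, ← hcr]
      constructor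
      · rintro ⟨z, hz, rfl⟩
        exact ⟨⟨z, hz⟩, by simp only [hz, dif_pos, hk]⟩
      · rintro ⟨z, hz⟩
        refine ⟨z, z.2, hgi ?_⟩
        simp only [z.2, dif_pos, hk, hz]
  choose φ hφc hφi hφV using hφ
  have hunion : ⋃ i, φ i '' closedBall 0 1 = g ⁻¹' ⋃ i, V i := by
    simp only [hφV, preimage_iUnion]
  have hWc : IsCompact (g ⁻¹' Wᶜ) :=
    (hg.isInducing.isCompact_preimage_iff (hrange Wᶜ fun h => h hvW)).2 hWo.isClosed_compl.isCompact
  obtain ⟨R, hR, hWR⟩ := hWc.isBounded.subset_closedBall_lt 0 0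
  have hmem : ∀ z, R < ‖z‖ → g z ∈ W := fun z hz => by
    by_contra h
    exact (mem_closedBall_zero_iff.1 (hWR h)).not_gt hz
  have hvN : (g '' closedBall 0 R)ᶜ ∈ nhds v := by
    refine ((isCompact_closedBall _ _).image hgc).isClosed.isOpen_compl.mem_nhds ?_
    rintro ⟨z, -, hz⟩
    exact (hgv ▸ ⟨z, hz⟩ : v ∈ ({v}ᶜ : Set X)) rfl
  have hWv : IsPreconnected (W \ {v}) := by
    refine hWp.diff_singleton_of_mem_nhds hvN ?_ ?_
    · intro x hx
      by_contra hxW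
      obtain ⟨z, rfl⟩ := hrange Wᶜ (fun h => h hvW) hxW
      exact hx ⟨z, hWR hxW, rfl⟩
    · convert (isPreconnected_setOf_lt_norm hR).image g hgc.continuousOn using 1
      ext x
      constructor
      · rintro ⟨hx, hxv⟩
        obtain ⟨z, rfl⟩ := hgv.symm.subset hxv
        refine ⟨z, not_le.1 fun hle => hx ⟨z, mem_closedBall_zero_iff.2 hle, rfl⟩, rfl⟩
      · rintro ⟨z, hz, rfl⟩
        refine ⟨?_, hgv.subset ⟨z, rfl⟩⟩
        rintro ⟨w, hw, he⟩
        rw [hgi he] at hw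
        exact (mem_closedBall_zero_iff.1 hw).not_gt hz
  have hdisc : IsDiscUnionComplement φ (g ⁻¹' W) :=
    { continuousOn := hφc
      injOn := hφi
      isConnected := by
        have := hconn.preimage_of_isOpenMap hgi hgo
          (hrange _ fun h => hvV (iUnion_mono (fun i => interior_subset) h))
        simpa only [hφV, ← hgo.preimage_interior_eq_interior_preimage hgc, ← preimage_iUnion]
          using this
      isOpen := hWo.preimage hgc
      isPreconnected := by
        convert hWv.preimage_of_isOpenMap hgi hgo (hrange _ fun h => h.2 rfl) using 1
        ext z
        have : g z ≠ v := hgv.subset ⟨z, rfl⟩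
        simp [this]
      disjoint := by
        rw [hunion]
        exact hWV.preimage g
      frontier_subset := by
        rw [hunion, ← hgo.preimage_frontier_eq_frontier_preimage hgc]
        exact preimage_mono hfW
      exists_norm_le := ⟨R + 1, fun z hz => hmem z (by linarith)⟩ }
  obtain ⟨e⟩ := hdisc.nonempty_homeomorph_circle
  have himage : g '' frontier (g ⁻¹' W) = frontier W := by
    rw [← hgo.preimage_frontier_eq_frontier_preimage hgc,
      image_preimage_eq_of_subset (hrange _ fun h => hvV (hfW h))]
  exact ⟨(Homeomorph.setCongr himage).symm.trans
    ((hg.isEmbedding.homeomorphImage _).symm.trans e)⟩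

theorem LinearIsometryEquiv.nonempty_circle_homeomorph_sphere {E : Type*} [NormedAddCommGroup E]
    [NormedSpace ℝ E] (L : ℂ ≃ₗᵢ[ℝ] E) : Nonempty (Circle ≃ₜ sphere (0 : E) 1) :=
  ⟨{  toFun := fun c => ⟨L c, by rw [mem_sphere_zero_iff_norm, L.norm_map, Circle.norm_coe]⟩
      invFun := fun p => ⟨L.symm p, by simp [Submonoid.unitSphere]⟩
      left_inv := fun c => by ext; simp
      right_inv := fun p => by ext; simp
      continuous_toFun := by fun_prop
      continuous_invFun := by fun_prop }⟩

theorem stmt_17 (n : ℕ) (V : Fin n → Set Sph)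
    (hclosed : ∀ i, IsClosed (V i))
    (hdisk : ∀ i, Nonempty ((V i) ≃ₜ (closedBall (0 : Plane) 1)))
    (hconn : IsConnected (⋃ i, interior (V i)))
    (hne : ((⋃ i, V i)ᶜ : Set Sph).Nonempty)
    (W : Set Sph)
    (hWcomp : ∃ x ∈ (⋃ i, V i)ᶜ, W = connectedComponentIn (⋃ i, V i)ᶜ x) :
    Nonempty ((frontier W : Set Sph) ≃ₜ (Metric.sphere (0 : Plane) 1)) := by
  obtain ⟨v, hv, rfl⟩ := hWcomp
  have hO : IsOpen (⋃ i, V i)ᶜ := (isClosed_iUnion_of_finite hclosed).isOpen_compl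
  have : Fact (Module.finrank ℝ (EuclideanSpace ℝ (Fin 3)) = 2 + 1) := ⟨by simp⟩
  have : LocallyConnectedSpace Sph := ChartedSpace.locallyConnectedSpace Plane Sph
  let L : ℂ ≃ₗᵢ[ℝ] Plane := Complex.orthonormalBasisOneI.repr
  have hs : Topology.IsOpenEmbedding (stereographic' 2 v).symm :=
    (stereographic' 2 v).symm.isOpenEmbedding (stereographic'_target v)
  have hg : Topology.IsOpenEmbedding ((stereographic' 2 v).symm ∘ L) :=
    hs.comp L.toHomeomorph.isOpenEmbedding
  have hgr : range ((stereographic' 2 v).symm ∘ L) = {v}ᶜ := by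
    rw [L.surjective.range_comp, ← image_univ, ← stereographic'_target v,
      OpenPartialHomeomorph.symm_image_target_eq_source, stereographic'_source]
  obtain ⟨e⟩ := nonempty_frontier_homeomorph_circle hg hgr (V := V) (fun i => by
      obtain ⟨f⟩ := hdisk i
      refine ⟨fun z => f.symm ⟨L z, by
        rw [mem_closedBall_zero_iff, L.norm_map]
        exact mem_closedBall_zero_iff.1 z.2⟩, ?_, ?_, ?_⟩
      · exact continuous_subtype_val.comp (f.symm.continuous.comp (by fun_prop))
      · intro z w he
        have := congrArg Subtype.val (f.symm.injective (Subtype.ext he))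
        exact Subtype.ext (L.injective this)
      · ext x
        constructor
        · rintro ⟨z, rfl⟩
          exact (f.symm _).2
        · intro hx
          refine ⟨⟨L.symm (f ⟨x, hx⟩), by
            rw [mem_closedBall_zero_iff, L.symm.norm_map]
            exact mem_closedBall_zero_iff.1 (f ⟨x, hx⟩).2⟩, ?_⟩
          simp) hconn hO.connectedComponentIn isPreconnected_connectedComponentIn
    (mem_connectedComponentIn hv)
    (disjoint_compl_left.mono_left (connectedComponentIn_subset _ _))
    (by simpa using frontier_connectedComponentIn_subset hO v)
  obtain ⟨e'⟩ := L.nonempty_circle_homeomorph_sphere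
  exact ⟨e.trans e'⟩
end
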